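/- Let p be an odd prime, G = C × H where C ≅ C₄ and H ≅ C_p × C_p, K ∈ Sup₂^min(G_r), and 𝒜 = V(K,G). If C is not an 𝒜-subgroup, then one of the following holds: (1) rk(𝒜) = 2; (2) 𝒜 is the tensor product of two S-rings over proper nontrivial subgroups of G; (3) 𝒜 is a nontrivial S = U/L-wreath product for some 𝒜-section S = U/L, satisfying one of the conditions (CA), (CA'), (CA''). -/

import Mathlib

open scoped Pointwise

noncomputable section

namespace Paper

/-- The element `∑_{x ∈ X} x` of the integer group ring `ℤG`. -/
def sumElems {G : Type*} [Group G] [Finite G] (X : Set G) : MonoidAlgebra ℤ G :=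
  ∑ x ∈ X.toFinite.toFinset, MonoidAlgebra.single x (1 : ℤ)

/-- A Schur ring (S-ring) over a finite group `G`, described by the partition of `G`
into its basic sets: the partition contains `{1}`, is closed under taking inverses,
and its `ℤ`-span inside the group ring `ℤG` is closed under multiplication
(hence is a subring of `ℤG`). -/
structure SRing (G : Type*) [Group G] [Finite G] where
  basic : Set (Set G)
  nonempty : ∀ X ∈ basic, X.Nonempty
  cover : ∀ g : G, ∃! X, X ∈ basic ∧ g ∈ X
  one_mem : ({1} : Set G) ∈ basic
  inv_mem : ∀ X ∈ basic, X⁻¹ ∈ basic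
  mul_mem : ∀ a b : MonoidAlgebra ℤ G,
    a ∈ Submodule.span ℤ (sumElems '' basic) →
    b ∈ Submodule.span ℤ (sumElems '' basic) →
    a * b ∈ Submodule.span ℤ (sumElems '' basic)

namespace SRing

/-- The `ℤ`-module underlying an S-ring. -/
def span {G : Type*} [Group G] [Finite G] (A : SRing G) :
    Submodule ℤ (MonoidAlgebra ℤ G) :=
  Submodule.span ℤ (sumElems '' A.basic)

/-- A set `X ⊆ G` is an `𝒜`-set if `∑_{x ∈ X} x ∈ 𝒜`. -/
def IsASet {G : Type*} [Group G] [Finite G] (A : SRing G) (X : Set G) : Prop :=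
  sumElems X ∈ A.span

/-- A subgroup which is an `𝒜`-set is an `𝒜`-subgroup. -/
def IsASubgroup {G : Type*} [Group G] [Finite G] (A : SRing G) (H : Subgroup G) : Prop :=
  A.IsASet (H : Set G)

end SRing

/-- The arc set `R(X) = {(g, xg) : x ∈ X, g ∈ G}` of the Cayley digraph `Cay(G, X)`. -/
def Rel {G : Type*} [Group G] (X : Set G) : Set (G × G) := {p | p.2 * p.1⁻¹ ∈ X}

/-- `f : G ≃ G'` is an isomorphism from the S-ring `A` over `G` to the S-ring `B`
over `G'` if `{R(X)^f : X ∈ 𝒮(A)} = {R(Y) : Y ∈ 𝒮(B)}`. -/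
def IsSRingIso {G G' : Type*} [Group G] [Finite G] [Group G'] [Finite G']
    (A : SRing G) (B : SRing G') (f : G ≃ G') : Prop :=
  (fun X => Prod.map f f '' Rel X) '' A.basic = Rel '' B.basic

/-- The automorphism group `Aut(𝒜)` of an S-ring, as a set of permutations of `G`. -/
def SRing.autSet {G : Type*} [Group G] [Finite G] (A : SRing G) : Set (Equiv.Perm G) :=
  {f | ∀ X ∈ A.basic, Prod.map f f '' Rel X = Rel X}

/-- The set `Iso(𝒜)` of isomorphisms from `𝒜` onto S-rings over the same group `G`. -/
def SRing.isoSet {G : Type*} [Group G] [Finite G] (A : SRing G) : Set (Equiv.Perm G) :=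
  {f | ∃ B : SRing G, IsSRingIso A B f}

/-- `Aut(G)` as a set of permutations of `G`. -/
def autPerm (G : Type*) [Group G] : Set (Equiv.Perm G) :=
  Set.range fun φ : G ≃* G => (φ.toEquiv : Equiv.Perm G)

/-- A CI-S-ring: `Aut(𝒜)·Aut(G) = Iso(𝒜)`. -/
def SRing.IsCI {G : Type*} [Group G] [Finite G] (A : SRing G) : Prop :=
  A.autSet * autPerm G = A.isoSet

/-- The orbits on `G` of a set of automorphisms of `G`. -/
def setOrbits {G : Type*} [Group G] (Δ : Set (MulAut G)) : Set (Set G) :=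
  Set.range fun g : G => (fun φ : MulAut G => φ g) '' Δ

/-- An S-ring is cyclotomic if its basic sets are exactly the orbits of some
subgroup `K ≤ Aut(G)`. -/
def SRing.IsCyclotomic {G : Type*} [Group G] [Finite G] (A : SRing G) : Prop :=
  ∃ K : Subgroup (MulAut G), A.basic = setOrbits (K : Set (MulAut G))

/-- `Aut_G(𝒜) = Aut(𝒜) ∩ Aut(G)`, as a set of automorphisms of `G`. -/
def SRing.autGSet {G : Type*} [Group G] [Finite G] (A : SRing G) : Set (MulAut G) :=
  {φ | (φ.toEquiv : Equiv.Perm G) ∈ A.autSet}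

/-- A (cyclotomic) S-ring is Cayley minimal if `Aut_G(𝒜)` is the only subgroup of
`Aut(G)` whose orbits on `G` coincide with those of `Aut_G(𝒜)`. -/
def SRing.IsCayleyMinimal {G : Type*} [Group G] [Finite G] (A : SRing G) : Prop :=
  ∀ K : Subgroup (MulAut G),
    setOrbits (K : Set (MulAut G)) = setOrbits A.autGSet →
    (K : Set (MulAut G)) = A.autGSet

/-- `rad(X) = {g ∈ G : gX = Xg = X}`. -/
def rad {G : Type*} [Group G] (X : Set G) : Set G := {g | {g} * X = X ∧ X * {g} = X}

/-- The class `𝓔_c` of finite abelian groups all of whose Sylow subgroups are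
elementary abelian or isomorphic to `C₄`. -/
def InEc (G : Type*) [CommGroup G] [Finite G] : Prop :=
  ∀ p : ℕ, p.Prime → ∀ P : Sylow p G,
    (∀ x : ↥(P : Subgroup G), x ^ p = 1) ∨
    Nonempty (↥(P : Subgroup G) ≃* Multiplicative (ZMod 4))

/-- A finite group `G` is a `DCI`-group if any two Cayley digraphs over `G` that are
isomorphic as digraphs are Cayley isomorphic. -/
def IsDCIGroup (G : Type*) [Group G] : Prop :=
  ∀ S T : Set G,
    (∃ f : G ≃ G, ∀ g h : G, h * g⁻¹ ∈ S ↔ f h * (f g)⁻¹ ∈ T) →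
    ∃ φ : G ≃* G, ⇑φ '' S = T

/-- The subgroup `G_r ≤ Sym(G)` of right translations of `G`. -/
def rightTranslations (G : Type*) [Group G] : Subgroup (Equiv.Perm G) where
  carrier := Set.range fun g : G => Equiv.mulRight g
  one_mem' := ⟨1, by ext x; simp⟩
  mul_mem' := by
    rintro _ _ ⟨a, rfl⟩ ⟨b, rfl⟩
    exact ⟨b * a, by ext x; simp [mul_assoc]⟩
  inv_mem' := by
    rintro _ ⟨a, rfl⟩
    exact ⟨a⁻¹, by ext x; simp⟩

/-- The basic sets of the S-ring `V(K, G)`: the orbits of the stabilizer `K_e`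
of the identity on `G`. -/
def VBasic {G : Type*} [Group G] (K : Subgroup (Equiv.Perm G)) : Set (Set G) :=
  Set.range fun g : G => MulAction.orbit (MulAction.stabilizer K (1 : G)) g

/-- A subgroup `R ≤ Sym(G)` is regular if for all `g, h ∈ G` there is a
unique `r ∈ R` with `r(g) = h`. -/
def IsRegularSubgroup {G : Type*} [Group G] (R : Subgroup (Equiv.Perm G)) : Prop :=
  ∀ g h : G, ∃! r : R, (r : Equiv.Perm G) g = h

/-- `K ∈ Sup(G_r)`. -/
def InSup {G : Type*} [Group G] (K : Subgroup (Equiv.Perm G)) : Prop :=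
  rightTranslations G ≤ K

/-- `K ∈ Sup₂(G_r)`, i.e. `K ≥ G_r` and `K = K^{(2)} = Aut(V(K,G))`. -/
def InSup2 {G : Type*} [Group G] [Finite G] (K : Subgroup (Equiv.Perm G)) : Prop :=
  InSup K ∧
    (K : Set (Equiv.Perm G)) =
      {f : Equiv.Perm G | ∀ X ∈ VBasic K, Prod.map (⇑f) (⇑f) '' Rel X = Rel X}

/-- `K₁ ⪯_G K₂`: `K₁ ≤ K₂` and every regular subgroup of `K₂` isomorphic to `G`
is conjugate in `K₂` to a subgroup of `K₁`. -/
def GComplete {G : Type*} [Group G] (K₁ K₂ : Subgroup (Equiv.Perm G)) : Prop :=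
  K₁ ≤ K₂ ∧ ∀ R : Subgroup (Equiv.Perm G), R ≤ K₂ → IsRegularSubgroup R →
    Nonempty (↥R ≃* G) → ∃ k ∈ K₂, ∀ r ∈ R, k * r * k⁻¹ ∈ K₁

/-- `K ∈ Sup₂^min(G_r)`: a minimal element of `Sup₂(G_r)` with respect to `⪯_G`. -/
def InSup2Min {G : Type*} [Group G] [Finite G] (K : Subgroup (Equiv.Perm G)) : Prop :=
  InSup2 K ∧ ∀ K' : Subgroup (Equiv.Perm G), InSup2 K' → GComplete K' K → K' = K

/-- The basic sets of the restriction `𝒜_U` of `𝒜` to an `𝒜`-subgroup `U`: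
the basic sets of `𝒜` contained in `U`, viewed inside `U`. -/
def restrictBasic {G : Type*} [Group G] [Finite G] (A : SRing G) (U : Subgroup G) :
    Set (Set ↥U) :=
  {Y : Set ↥U | Subtype.val '' Y ∈ A.basic}

/-- The basic sets of the quotient S-ring `𝒜_{G/L}`: the images of the basic
sets of `𝒜` under the canonical epimorphism `G → G/L`. -/
def quotBasic {G : Type*} [CommGroup G] [Finite G] (A : SRing G) (L : Subgroup G) :
    Set (Set (G ⧸ L)) :=
  (fun X => QuotientGroup.mk '' X) '' A.basic

/-- The basic sets of the S-ring `𝒜_S` on the section `S = U/L`: the images under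
the canonical epimorphism `U → U/L` of the basic sets of `𝒜` contained in `U`. -/
def secBasic {G : Type*} [CommGroup G] [Finite G] (A : SRing G) (U L : Subgroup G) :
    Set (Set (↥U ⧸ L.subgroupOf U)) :=
  {Z | ∃ X ∈ A.basic, X ⊆ (U : Set G) ∧
    Z = QuotientGroup.mk '' (Subtype.val ⁻¹' X : Set ↥U)}

/-- The set of bijections of `H ⧸ N` induced by members of `Δ ⊆ Sym(H)`
permuting the `N`-cosets. -/
def inducedOnQuot {H : Type*} [CommGroup H] (N : Subgroup H) (Δ : Set (Equiv.Perm H)) :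
    Set (Equiv.Perm (H ⧸ N)) :=
  {σ | ∃ f ∈ Δ, ∀ x : H, σ (QuotientGroup.mk x) = QuotientGroup.mk (f x)}

/-- The canonical (injective) homomorphism `U/L → G/L` for `L ≤ U ≤ G`. -/
def secIncl {G : Type*} [CommGroup G] (U L : Subgroup G) :
    (↥U ⧸ L.subgroupOf U) →* G ⧸ L :=
  QuotientGroup.map (L.subgroupOf U) L U.subtype (fun _ hx => hx)

/-- The set of bijections of the section `S = U/L` induced by members of
`Δ ⊆ Sym(G/L)` preserving `S` (i.e. permuting the `L`-cosets contained in `U`). -/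
def inducedOnSec {G : Type*} [CommGroup G] (U L : Subgroup G)
    (Δ : Set (Equiv.Perm (G ⧸ L))) : Set (Equiv.Perm (↥U ⧸ L.subgroupOf U)) :=
  {σ | ∃ φ ∈ Δ, ∀ x : ↥U,
    φ (QuotientGroup.mk (x : G) : G ⧸ L) = secIncl U L (σ (QuotientGroup.mk x))}

/-- The basic sets of the S-ring `(ℤL ⊗ 𝒜_V) ≀_{(V×L)/V} ℤ(U/V)` over `U`,
where `Lu, V ≤ U` and `𝒜_V` is the restriction of `𝒜_U` to `V`. -/
def tensorWreathBasic {U : Type*} [CommGroup U] [Finite U] (AU : SRing U)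
    (Lu V : Subgroup U) : Set (Set U) :=
  {Z | (∃ l ∈ Lu, ∃ X ∈ AU.basic, X ⊆ (V : Set U) ∧ Z = l • X) ∨
       (∃ u : U, u ∉ Lu ⊔ V ∧ Z = u • (V : Set U))}

/-- Condition (CA): `𝒜_S = ℤS`. -/
def CondCA {G : Type*} [CommGroup G] [Finite G] (A : SRing G) (U L : Subgroup G) : Prop :=
  ∀ AS : SRing (↥U ⧸ L.subgroupOf U), AS.basic = secBasic A U L →
    AS.basic = Set.range fun s => ({s} : Set (↥U ⧸ L.subgroupOf U))

/-- Condition (CA'): `𝒜_U` or `𝒜_{G/L}` is cyclotomic and `𝒜_S` is Cayley minimal. -/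
def CondCA' {G : Type*} [CommGroup G] [Finite G] (A : SRing G) (U L : Subgroup G) : Prop :=
  ((∀ AU : SRing ↥U, AU.basic = restrictBasic A U → AU.IsCyclotomic) ∨
   (∀ AQ : SRing (G ⧸ L), AQ.basic = quotBasic A L → AQ.IsCyclotomic)) ∧
  (∀ AS : SRing (↥U ⧸ L.subgroupOf U), AS.basic = secBasic A U L → AS.IsCayleyMinimal)

/-- Condition (CA''): `U ≅ C_{4p}`, `L ≅ C₂` and
`𝒜_U = (ℤL ⊗ 𝒜_V) ≀_{(V×L)/V} ℤ(U/V)` for an `𝒜_U`-subgroup `V` of order `p`. -/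
def CondCA'' {G : Type*} [CommGroup G] [Finite G] (p : ℕ) (A : SRing G)
    (U L : Subgroup G) : Prop :=
  Nat.card ↥U = 4 * p ∧ IsCyclic ↥U ∧ Nat.card ↥L = 2 ∧
  ∀ AU : SRing ↥U, AU.basic = restrictBasic A U →
    ∃ V : Subgroup ↥U, AU.IsASubgroup V ∧ Nat.card ↥V = p ∧
      AU.basic = tensorWreathBasic AU (L.subgroupOf U) V

/-- `𝒜 = 𝒜_{G₁} ⊗ 𝒜_{G₂}` for `G = G₁ × G₂` (internally). -/
def IsTensorDecomp {G : Type*} [CommGroup G] [Finite G] (A : SRing G)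
    (G₁ G₂ : Subgroup G) : Prop :=
  A.IsASubgroup G₁ ∧ A.IsASubgroup G₂ ∧ G₁ ⊓ G₂ = ⊥ ∧ G₁ ⊔ G₂ = ⊤ ∧
  A.basic = {Z | ∃ X ∈ A.basic, ∃ Y ∈ A.basic,
    X ⊆ (G₁ : Set G) ∧ Y ⊆ (G₂ : Set G) ∧ Z = X * Y}

/-- `𝒜` is the tensor product of two S-rings over proper nontrivial subgroups of `G`. -/
def TensorConclusion {G : Type*} [CommGroup G] [Finite G] (A : SRing G) : Prop :=
  ∃ G₁ G₂ : Subgroup G, G₁ ≠ ⊥ ∧ G₁ ≠ ⊤ ∧ G₂ ≠ ⊥ ∧ G₂ ≠ ⊤ ∧ IsTensorDecomp A G₁ G₂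

/-- `𝒜` is a nontrivial `S = U/L`-wreath product satisfying one of the
conditions (CA), (CA'), (CA''). -/
def WreathConclusion {G : Type*} [CommGroup G] [Finite G] (p : ℕ) (A : SRing G) : Prop :=
  ∃ U L : Subgroup G, L ≤ U ∧ A.IsASubgroup U ∧ A.IsASubgroup L ∧ L ≠ ⊥ ∧ U ≠ ⊤ ∧
    (∀ X ∈ A.basic, ¬ X ⊆ (U : Set G) → (L : Set G) ⊆ rad X) ∧
    (CondCA A U L ∨ CondCA' A U L ∨ CondCA'' p A U L)


namespace SRing

variable {G : Type*} [Group G] [Finite G] (A : SRing G)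

/-- The basic set containing a given element. -/
def cell (g : G) : Set G := (A.cover g).choose

lemma cell_mem_basic (g : G) : A.cell g ∈ A.basic := (A.cover g).choose_spec.1.1

lemma mem_cell (g : G) : g ∈ A.cell g := (A.cover g).choose_spec.1.2

lemma eq_cell {X : Set G} (hX : X ∈ A.basic) {g : G} (hg : g ∈ X) : X = A.cell g :=
  (A.cover g).choose_spec.2 X ⟨hX, hg⟩

lemma cell_eq_of_mem {g h : G} (hh : h ∈ A.cell g) : A.cell h = A.cell g :=
  (A.eq_cell (A.cell_mem_basic g) hh).symm

lemma mem_cell_comm {g h : G} (hh : h ∈ A.cell g) : g ∈ A.cell h :=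
  A.cell_eq_of_mem hh ▸ A.mem_cell g

lemma cell_one : A.cell 1 = {1} := (A.eq_cell A.one_mem rfl).symm

open Classical in
lemma _root_.Paper.coeff_sumElems (X : Set G) (g : G) :
    (sumElems X).coeff g = if g ∈ X then 1 else 0 := by
  simp only [sumElems, MonoidAlgebra.coeff_sum, Finsupp.coe_finsetSum, Finset.sum_apply,
    MonoidAlgebra.coeff_single, Finsupp.single_apply]
  simp

lemma mem_span_iff (a : MonoidAlgebra ℤ G) :
    a ∈ A.span ↔ ∀ g, ∀ h ∈ A.cell g, a.coeff h = a.coeff g := by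
  classical
  constructor
  · intro ha
    induction ha using Submodule.span_induction with
    | mem x hx =>
      obtain ⟨X, hX, rfl⟩ := hx
      intro g h hh
      have : h ∈ X ↔ g ∈ X := by
        constructor
        · intro hX'
          rw [A.eq_cell hX hX']
          exact A.mem_cell_comm hh
        · intro hX'
          rw [A.eq_cell hX hX']
          exact hh
      simp [coeff_sumElems, this]
    | zero => simp
    | add x y _ _ hx hy =>
      intro g h hh
      simp [hx g h hh, hy g h hh]
    | smul r x _ hx =>
      intro g h hh
      rw [MonoidAlgebra.coeff_smul_apply, MonoidAlgebra.coeff_smul_apply, hx g h hh]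
  · intro ha
    have key : a = ∑ X ∈ A.basic.toFinite.toFinset.attach,
        a.coeff (A.nonempty X.1 ((Set.Finite.mem_toFinset _).1 X.2)).some • sumElems X.1 := by
      ext g
      simp only [MonoidAlgebra.coeff_sum, Finsupp.coe_finsetSum, Finset.sum_apply,
        MonoidAlgebra.coeff_smul_apply, coeff_sumElems]
      rw [Finset.sum_eq_single ⟨A.cell g, (Set.Finite.mem_toFinset _).2 (A.cell_mem_basic g)⟩]
      · have := (A.nonempty _ (A.cell_mem_basic g)).some_mem
        simp [A.mem_cell g, ha g _ this]
      · intro X _ hne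
        rw [if_neg, smul_zero]
        intro hg
        exact hne (Subtype.ext (A.eq_cell ((Set.Finite.mem_toFinset _).1 X.2) hg))
      · simp
    rw [key]
    refine Submodule.sum_mem _ fun X _ => Submodule.smul_mem _ _ (Submodule.subset_span ?_)
    exact ⟨X.1, (Set.Finite.mem_toFinset _).1 X.2, rfl⟩

lemma isASet_iff {X : Set G} : A.IsASet X ↔ ∀ g ∈ X, A.cell g ⊆ X := by
  classical
  rw [IsASet, mem_span_iff]
  simp only [coeff_sumElems]
  constructor
  · intro h g hg k hk
    by_contra hkX
    have := h g k hk
    simp [hg, hkX] at this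
  · intro h g k hk
    have : k ∈ X ↔ g ∈ X :=
      ⟨fun hkX => h k hkX (A.mem_cell_comm hk), fun hg => h g hg hk⟩
    simp [this]

variable {A}

lemma IsASet.cell_subset {X : Set G} (hX : A.IsASet X) {g : G} (hg : g ∈ X) : A.cell g ⊆ X :=
  A.isASet_iff.1 hX g hg

lemma IsASet.basic_subset {X B : Set G} (hX : A.IsASet X) (hB : B ∈ A.basic) {g : G}
    (hgB : g ∈ B) (hg : g ∈ X) : B ⊆ X := A.eq_cell hB hgB ▸ hX.cell_subset hg

lemma IsASet.of_basic {B : Set G} (hB : B ∈ A.basic) : A.IsASet B :=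
  A.isASet_iff.2 fun _ hg => (A.eq_cell hB hg).ge

lemma IsASet.cell (g : G) : A.IsASet (A.cell g) := .of_basic (A.cell_mem_basic g)

lemma IsASet.union {X Y : Set G} (hX : A.IsASet X) (hY : A.IsASet Y) : A.IsASet (X ∪ Y) :=
  A.isASet_iff.2 fun _ hg => hg.elim
    (fun h => (hX.cell_subset h).trans Set.subset_union_left)
    (fun h => (hY.cell_subset h).trans Set.subset_union_right)

lemma IsASet.compl {X : Set G} (hX : A.IsASet X) : A.IsASet Xᶜ :=
  A.isASet_iff.2 fun _ hg _ hk hkX => hg (hX.cell_subset hkX (A.mem_cell_comm hk))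

lemma isASet_one : A.IsASet ({1} : Set G) := .of_basic A.one_mem

lemma IsASet.inv {X : Set G} (hX : A.IsASet X) : A.IsASet X⁻¹ := by
  refine A.isASet_iff.2 fun g hg => ?_
  have h1 : (A.cell g⁻¹)⁻¹ = A.cell g :=
    A.eq_cell (A.inv_mem _ (A.cell_mem_basic _)) (by simpa using A.mem_cell g⁻¹)
  rw [← h1, Set.inv_subset_inv]
  exact hX.cell_subset hg

lemma IsASet.of_level {a : MonoidAlgebra ℤ G} (ha : a ∈ A.span) (P : ℤ → Prop) :
    A.IsASet {g | P (a.coeff g)} :=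
  A.isASet_iff.2 fun g hg k hk => by
    simpa [Set.mem_ofPred_eq, (A.mem_span_iff a).1 ha g k hk] using hg

/-- The set of elements translating one `𝒜`-set into another one is an `𝒜`-set. -/
lemma IsASet.transporter {X Y : Set G} (hX : A.IsASet X) (hY : A.IsASet Y) :
    A.IsASet {g | ∀ x ∈ X, g * x ∈ Y} := by
  classical
  have h := A.mul_mem _ _ hY hX.inv
  convert IsASet.of_level (A := A) h (fun n => n = (X⁻¹).toFinite.toFinset.card) using 1
  ext g
  have hc : (sumElems Y * sumElems X⁻¹).coeff g
      = ∑ x ∈ (X⁻¹).toFinite.toFinset, if g * x⁻¹ ∈ Y then (1 : ℤ) else 0 := by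
    rw [sumElems.eq_1 X⁻¹, Finset.mul_sum, MonoidAlgebra.coeff_sum, Finsupp.coe_finsetSum,
      Finset.sum_apply]
    simp [coeff_sumElems]
  simp only [Set.mem_ofPred_eq]
  rw [hc, Finset.sum_boole, Nat.cast_inj, Finset.card_filter_eq_iff]
  simp only [Set.Finite.mem_toFinset]
  constructor
  · intro h x hx
    exact h _ hx
  · intro h x hx
    simpa using h (x := x⁻¹) (by simpa using hx)

lemma IsASet.mul {X Y : Set G} (hX : A.IsASet X) (hY : A.IsASet Y) : A.IsASet (X * Y) := by
  convert (hY.inv.transporter hX.compl).compl using 1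
  ext g
  simp only [Set.mem_mul, Set.mem_compl_iff, Set.mem_ofPred_eq, not_forall, not_not]
  constructor
  · rintro ⟨x, hx, y, hy, rfl⟩
    exact ⟨y⁻¹, by simpa using hy, by simpa using hx⟩
  · rintro ⟨y, hy, hxy⟩
    exact ⟨_, hxy, y⁻¹, hy, by simp⟩

end SRing

lemma exists_sum_single_pow_prime {G : Type*} [CommGroup G] {q : ℕ} (hq : q.Prime)
    (s : Finset G) : ∃ r : MonoidAlgebra ℤ G,
      (∑ x ∈ s, MonoidAlgebra.single x (1 : ℤ)) ^ q
        = ∑ x ∈ s, MonoidAlgebra.single (x ^ q) (1 : ℤ) + q * r := by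
  classical
  induction s using Finset.induction_on with
  | empty => exact ⟨0, by simp [hq.ne_zero]⟩
  | insert a s ha ih =>
    obtain ⟨r, hr⟩ := ih
    obtain ⟨r', hr'⟩ := exists_add_pow_prime_eq hq (MonoidAlgebra.single a (1 : ℤ))
      (∑ x ∈ s, MonoidAlgebra.single x (1 : ℤ))
    refine ⟨r + MonoidAlgebra.single a (1 : ℤ) * (∑ x ∈ s, MonoidAlgebra.single x (1 : ℤ)) * r', ?_⟩
    rw [Finset.sum_insert ha, Finset.sum_insert ha, hr', hr, MonoidAlgebra.single_pow]
    simp only [one_pow]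
    ring

namespace SRing

variable {G : Type*} [CommGroup G] [Finite G] {A : SRing G}

/-- The Schur–Wielandt theorem on prime powers. -/
lemma IsASet.pow_prime {X : Set G} (hX : A.IsASet X) {q : ℕ} (hq : q.Prime) :
    A.IsASet {g | ¬ q ∣ {x | x ∈ X ∧ x ^ q = g}.ncard} := by
  classical
  obtain ⟨r, hr⟩ := exists_sum_single_pow_prime hq X.toFinite.toFinset
  have hpow : ∀ n : ℕ, 0 < n → sumElems X ^ n ∈ A.span := by
    intro n hn
    induction n, hn using Nat.le_induction with
    | base => exact (pow_one (sumElems X)).symm ▸ hX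
    | succ n _ ih => rw [pow_succ]; exact A.mul_mem _ _ ih hX
  convert IsASet.of_level (hpow q hq.pos) (fun n => ¬ (q : ℤ) ∣ n) using 1
  ext g
  have hc : (sumElems X ^ q).coeff g = {x | x ∈ X ∧ x ^ q = g}.ncard + q * r.coeff g := by
    rw [sumElems, hr, MonoidAlgebra.coeff_add, Finsupp.add_apply, MonoidAlgebra.coeff_sum,
      Finsupp.coe_finsetSum, Finset.sum_apply]
    congr 1
    · simp only [MonoidAlgebra.coeff_single, Finsupp.single_apply]
      rw [Finset.sum_boole]
      congr 1
      rw [Set.ncard_eq_toFinset_card _ (Set.toFinite _)]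
      congr 1
      ext x
      simp
    · rw [← nsmul_eq_mul, MonoidAlgebra.coeff_smul_apply, nsmul_eq_mul]
  simp only [Set.mem_ofPred_eq]
  rw [hc, Int.dvd_add_left (dvd_mul_right _ _), Int.natCast_dvd_natCast]

/-- Schur's theorem on multipliers. -/
lemma IsASet.pow_coprime {X : Set G} (hX : A.IsASet X) {m : ℕ} (hm : m.Coprime (Nat.card G)) :
    A.IsASet ((· ^ m) '' X) := by
  induction m using Nat.recOnMul generalizing X with
  | zero =>
    have : Subsingleton G := (Nat.card_eq_one_iff_unique.1 (by simpa using hm)).1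
    convert hX
    ext x
    constructor
    · rintro ⟨y, hy, _⟩
      rwa [Subsingleton.elim x y]
    · intro hx
      exact ⟨x, hx, Subsingleton.elim _ _⟩
  | one => simpa using hX
  | prime q hq =>
    convert hX.pow_prime hq using 1
    have hinj : Function.Injective (fun x : G => x ^ q) := (powCoprime hm.symm).injective
    ext g
    simp only [Set.mem_image, Set.mem_ofPred_eq]
    constructor
    · rintro ⟨x, hx, rfl⟩
      have : {y | y ∈ X ∧ y ^ q = x ^ q} = {x} := by
        ext y
        simp only [Set.mem_ofPred_eq, Set.mem_singleton_iff]
        exact ⟨fun h => hinj h.2, by rintro rfl; exact ⟨hx, rfl⟩⟩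
      rw [this, Set.ncard_singleton]
      exact hq.one_lt.ne' ∘ Nat.dvd_one.1
    · intro h
      by_contra hne
      apply h
      have : {y | y ∈ X ∧ y ^ q = g} = ∅ := by
        ext y
        simp only [Set.mem_ofPred_eq, Set.mem_empty_iff_false, iff_false]
        rintro ⟨h1, h2⟩
        exact hne ⟨y, h1, h2⟩
      rw [this]
      simp
  | mul a b iha ihb =>
    have h1 := iha (ihb hX (Nat.Coprime.coprime_mul_left hm)) (Nat.Coprime.coprime_mul_right hm)
    convert h1 using 1
    rw [Set.image_image]
    ext x
    simp [← pow_mul, mul_comm]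

/-- A power map with exponent coprime to the order permutes the basic sets. -/
lemma pow_cell {m : ℕ} (hm : m.Coprime (Nat.card G)) (g : G) :
    (· ^ m) '' A.cell g = A.cell (g ^ m) := by
  have hle : ∀ g, A.cell (g ^ m) ⊆ (· ^ m) '' A.cell g := fun g =>
    ((IsASet.cell g).pow_coprime hm).cell_subset ⟨g, A.mem_cell g, rfl⟩
  refine Set.Subset.antisymm ?_ (hle g)
  rintro _ ⟨x, hx, rfl⟩
  obtain ⟨n, hn, hmn⟩ : ∃ n : ℕ, n.Coprime (Nat.card G) ∧ ∀ y : G, (y ^ m) ^ n = y := by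
    have hpos : 0 < (Nat.card G).totient := Nat.totient_pos.2 Nat.card_pos
    refine ⟨m ^ ((Nat.card G).totient - 1), hm.pow_left _, fun y => ?_⟩
    rw [← pow_mul, mul_pow_sub_one hpos.ne']
    exact (pow_eq_pow_of_modEq (Nat.ModEq.pow_totient hm) pow_card_eq_one').trans (pow_one y)
  have h1 : x ∈ (· ^ n) '' A.cell (g ^ m) := by
    refine ((IsASet.cell (g ^ m)).pow_coprime hn).cell_subset ⟨g ^ m, A.mem_cell _, rfl⟩ ?_
    simpa only [hmn] using hx
  obtain ⟨y, hy, rfl⟩ := h1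
  simpa only [← pow_mul, mul_comm n m, pow_mul y m n, hmn] using hy

end SRing

/-- An internal decomposition of an abelian group as a cyclic group of order four, generated
by `c`, times an elementary abelian group `H` of order `p ^ 2`. -/
structure Frame {G : Type*} [CommGroup G] (p : ℕ) (c : G) (H : Subgroup G) : Prop where
  prime : p.Prime
  odd : Odd p
  pow_four : c ^ 4 = 1
  sq_notMem : c ^ 2 ∉ H
  pow_eq_one : ∀ h ∈ H, h ^ p = 1
  exists_pow_mul : ∀ g, ∃ i : ℕ, ∃ h ∈ H, g = c ^ i * h
  card : Nat.card H = p ^ 2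

namespace Frame

variable {G : Type*} [CommGroup G] {p : ℕ} {c : G} {H : Subgroup G}

lemma notMem (F : Frame p c H) : c ∉ H := fun h => F.sq_notMem (H.pow_mem h 2)

lemma pow_three_notMem (F : Frame p c H) : c ^ 3 ∉ H := fun h => by
  have h1 := H.pow_mem h 2
  rw [← pow_mul, show 3 * 2 = 4 + 2 by rfl, pow_add, F.pow_four, one_mul] at h1
  exact F.sq_notMem h1

lemma pow_mem_iff (F : Frame p c H) (n : ℕ) : c ^ n ∈ H ↔ 4 ∣ n := by
  rw [pow_eq_pow_mod n F.pow_four, Nat.dvd_iff_mod_eq_zero]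
  have : n % 4 < 4 := Nat.mod_lt _ (by norm_num)
  have h1 := F.notMem
  have h2 := F.sq_notMem
  have h3 := F.pow_three_notMem
  interval_cases n % 4 <;> simp_all [H.one_mem]

lemma exists_char (F : Frame p c H) : ∃ χ : G → ZMod 4, (∀ x y, χ (x * y) = χ x + χ y) ∧
    (∀ x, χ x = 0 ↔ x ∈ H) ∧ χ c = 1 := by
  choose i h hh hi using F.exists_pow_mul
  have key : ∀ (g k : G) (n : ℕ), k ∈ H → g = c ^ n * k → ((i g : ℕ) : ZMod 4) = n := by
    have aux : ∀ (m n : ℕ) (k l : G), k ∈ H → l ∈ H → c ^ m * k = c ^ n * l → m ≤ n →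
        (m : ZMod 4) = n := by
      intro m n k l hk hl he hle
      obtain ⟨d, rfl⟩ := Nat.exists_eq_add_of_le hle
      rw [pow_add, mul_assoc, mul_left_cancel_iff] at he
      have hd : c ^ d ∈ H := by
        rw [eq_mul_inv_of_mul_eq he.symm]
        exact H.mul_mem hk (H.inv_mem hl)
      rw [F.pow_mem_iff] at hd
      simp [(ZMod.natCast_eq_zero_iff d 4).2 hd]
    intro g k n hk he
    rcases le_total (i g) n with hle | hle
    · exact aux _ _ _ _ (hh g) hk ((hi g).symm.trans he) hle
    · exact (aux _ _ _ _ hk (hh g) (he.symm.trans (hi g)) hle).symm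
  refine ⟨fun g => (i g : ℕ), fun x y => ?_, fun x => ?_, ?_⟩
  · change ((i (x * y) : ℕ) : ZMod 4) = (i x : ℕ) + (i y : ℕ)
    rw [key (x * y) (h x * h y) (i x + i y) (H.mul_mem (hh x) (hh y)), Nat.cast_add]
    conv_lhs => rw [hi x, hi y]
    rw [pow_add]
    exact mul_mul_mul_comm _ _ _ _
  · constructor
    · intro h0
      rw [ZMod.natCast_eq_zero_iff] at h0
      rw [hi x]
      exact H.mul_mem ((F.pow_mem_iff _).2 h0) (hh x)
    · intro hx
      change ((i x : ℕ) : ZMod 4) = 0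
      rw [key x x 0 hx (by simp)]
      simp
  · change ((i c : ℕ) : ZMod 4) = 1
    rw [key c 1 1 H.one_mem (by simp)]
    simp

end Frame

lemma mem_rel_iff {G : Type*} [Group G] {X : Set G} {x y : G} :
    (x, y) ∈ Rel X ↔ y * x⁻¹ ∈ X := Iff.rfl

lemma map_image_rel_iff {G : Type*} [Group G] [Finite G] {X : Set G} {f : Equiv.Perm G} :
    Prod.map f f '' Rel X = Rel X ↔ ∀ x y, f y * (f x)⁻¹ ∈ X ↔ y * x⁻¹ ∈ X := by
  constructor
  · intro h x y
    rw [← mem_rel_iff, ← h]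
    constructor
    · rintro ⟨⟨a, b⟩, hab, he⟩
      simp only [Prod.map_apply, Prod.mk.injEq, EmbeddingLike.apply_eq_iff_eq] at he
      obtain ⟨rfl, rfl⟩ := he
      exact hab
    · intro hxy
      exact ⟨(x, y), hxy, rfl⟩
  · intro h
    ext ⟨x, y⟩
    constructor
    · rintro ⟨⟨a, b⟩, hab, he⟩
      simp only [Prod.map_apply, Prod.mk.injEq] at he
      obtain ⟨rfl, rfl⟩ := he
      exact (h a b).2 hab
    · intro hxy
      refine ⟨(f.symm x, f.symm y), (h _ _).1 ?_, by simp⟩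
      simpa using mem_rel_iff.1 hxy

lemma mem_orbit_stabilizer_iff {G : Type*} [Group G] {K : Subgroup (Equiv.Perm G)} {g x : G} :
    x ∈ MulAction.orbit (MulAction.stabilizer K (1 : G)) g ↔ ∃ k ∈ K, k 1 = 1 ∧ k g = x := by
  constructor
  · rintro ⟨⟨⟨k, hk⟩, h1⟩, rfl⟩
    exact ⟨k, hk, h1, rfl⟩
  · rintro ⟨k, hk, h1, rfl⟩
    exact ⟨⟨⟨k, hk⟩, h1⟩, rfl⟩

lemma InSup.mulRight_mem {G : Type*} [Group G] {K : Subgroup (Equiv.Perm G)} (hK : InSup K)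
    (g : G) : Equiv.mulRight g ∈ K := hK ⟨g, rfl⟩

/-- Elements of `K ≥ G_r` preserve the Cayley relations of the orbits of `K_e`. -/
lemma InSup.mem_orbit_iff {G : Type*} [Group G] {K : Subgroup (Equiv.Perm G)} (hK : InSup K)
    {f : Equiv.Perm G} (hf : f ∈ K) (g x y : G) :
    f y * (f x)⁻¹ ∈ MulAction.orbit (MulAction.stabilizer K (1 : G)) g ↔
      y * x⁻¹ ∈ MulAction.orbit (MulAction.stabilizer K (1 : G)) g := by
  have aux : ∀ f ∈ K, ∀ x y,
      y * x⁻¹ ∈ MulAction.orbit (MulAction.stabilizer K (1 : G)) g →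
      f y * (f x)⁻¹ ∈ MulAction.orbit (MulAction.stabilizer K (1 : G)) g := by
    intro f hf x y h
    obtain ⟨k, hk, h1, h2⟩ := mem_orbit_stabilizer_iff.1 h
    refine mem_orbit_stabilizer_iff.2
      ⟨Equiv.mulRight (f x)⁻¹ * f * Equiv.mulRight x * k,
        K.mul_mem (K.mul_mem (K.mul_mem (hK.mulRight_mem _) hf) (hK.mulRight_mem _)) hk, ?_, ?_⟩
    · simp [h1]
    · simp [h2]
  refine ⟨fun h => ?_, aux f hf x y⟩
  simpa using aux f⁻¹ (K.inv_mem hf) _ _ h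

set_option maxRecDepth 100000 in
lemma exists_conj_four_cycle_vec : ∀ a b c d : Fin 4, Function.Injective ![a, b, c, d] →
    (∀ j, ∃ i : Fin 4, (![a, b, c, d])^[i] 0 = j) →
    ∃ i j : Fin 4, ∃ e : Fin 4, ∀ x,
      (![a, b, c, d])^[i] ((![a, b, c, d]) (x) + j) = (![a, b, c, d])^[i] (x + j) + e := by
  decide
lemma exists_conj_four_cycle {s : ZMod 4 → ZMod 4}
    (hinj : Function.Injective s) (h : ∀ j, ∃ i : Fin 4, s^[i] 0 = j) :
    ∃ i j : Fin 4, ∃ a : ZMod 4, ∀ x,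
      s^[i] (s x + (j : ℕ)) = s^[i] (x + (j : ℕ)) + a := by
  have hs : s = (![s 0, s 1, s 2, s 3] : Fin 4 → Fin 4) := by
    funext x
    change Fin 4 at x
    fin_cases x <;> rfl
  have h1 := exists_conj_four_cycle_vec (s 0) (s 1) (s 2) (s 3)
  rw [← hs] at h1
  obtain ⟨i, j, a, ha⟩ := h1 hinj h
  have hj : ((j : ℕ) : ZMod 4) = j := ZMod.natCast_zmod_val (n := 4) j
  exact ⟨i, j, a, fun x => by rw [hj]; exact ha x⟩

/-- Minimality forces the quotient modulo `H` to be discrete. -/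
lemma InSup2Min.mul_inv_mem {G : Type*} [CommGroup G] [Finite G] {p : ℕ} {c : G}
    {H : Subgroup G} (F : Frame p c H) {K : Subgroup (Equiv.Perm G)} (hK : InSup2Min K)
    {A : SRing G} (hA : A.basic = VBasic K) (hH : A.IsASubgroup H) {g x : G}
    (hx : x ∈ A.cell g) : x * g⁻¹ ∈ H := by
  obtain ⟨χ, hmul, hker, hc⟩ := F.exists_char
  have hsup := hK.1.1
  have hone : χ 1 = 0 := (hker 1).2 H.one_mem
  have hinv : ∀ x, χ x⁻¹ = -χ x := fun x => by
    rw [eq_neg_iff_add_eq_zero, ← hmul]; simpa using hone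
  have hpow : ∀ x (n : ℕ), χ (x ^ n) = n * χ x := fun x n => by
    induction n with
    | zero => simpa using hone
    | succ n ih => rw [pow_succ, hmul, ih]; push_cast; ring
  have hlift : ∀ i : ZMod 4, χ (c ^ i.val) = i := fun i => by
    rw [hpow, hc, mul_one, ZMod.natCast_zmod_val]
  have hχ : ∀ x y, χ x = χ y ↔ x * y⁻¹ ∈ H := fun x y => by
    rw [← hker, hmul, hinv, ← sub_eq_add_neg, sub_eq_zero]
  have hcell : ∀ g, A.cell g = MulAction.orbit (MulAction.stabilizer K (1 : G)) g := fun g =>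
    (A.eq_cell (hA ▸ ⟨g, rfl⟩) (MulAction.mem_orbit_self g)).symm
  have hpres : ∀ f ∈ K, ∀ x y, χ x = χ y → χ (f x) = χ (f y) := by
    intro f hf x y h
    rw [hχ] at h ⊢
    refine SRing.IsASet.cell_subset hH h ?_
    rw [hcell, hsup.mem_orbit_iff hf]
    exact MulAction.mem_orbit_self _
  obtain ⟨φ, hφ⟩ : ∃ φ : K →* Equiv.Perm (ZMod 4), ∀ (f : K) x,
      χ ((f : Equiv.Perm G) x) = φ f (χ x) := by
    obtain ⟨s, hs⟩ : ∃ s : K → ZMod 4 → ZMod 4, ∀ (f : K) x,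
        s f (χ x) = χ ((f : Equiv.Perm G) x) :=
      ⟨fun f i => χ ((f : Equiv.Perm G) (c ^ i.val)), fun f x => hpres f f.2 _ _ (hlift _)⟩
    have hs' : ∀ (f g : K) i, s f (s g i) = s (f * g) i := fun f g i => by
      rw [← hlift i, hs, hs, hs]; rfl
    have hs1 : ∀ i, s 1 i = i := fun i => by
      rw [← hlift i, hs]; rfl
    refine ⟨MonoidHom.mk' (fun f => ⟨s f, s f⁻¹, fun i => ?_, fun i => ?_⟩) fun f g => ?_,
      fun f x => (hs f x).symm⟩
    · rw [hs', inv_mul_cancel, hs1]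
    · rw [hs', mul_inv_cancel, hs1]
    · ext1 i
      exact (hs' f g i).symm
  let K' : Subgroup (Equiv.Perm G) :=
    { carrier := {f | f ∈ K ∧ ∃ a : ZMod 4, ∀ x, χ (f x) = χ x + a}
      one_mem' := ⟨K.one_mem, 0, fun x => by simp⟩
      mul_mem' := by
        rintro f g ⟨hf, a, ha⟩ ⟨hg, b, hb⟩
        exact ⟨K.mul_mem hf hg, b + a, fun x => by rw [Equiv.Perm.mul_apply, ha, hb, add_assoc]⟩
      inv_mem' := by
        rintro f ⟨hf, a, ha⟩
        refine ⟨K.inv_mem hf, -a, fun x => ?_⟩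
        have := ha (f⁻¹ x)
        rw [← Equiv.Perm.mul_apply, mul_inv_cancel, Equiv.Perm.one_apply] at this
        rw [this, add_neg_cancel_right] }
  have hK'K : K' ≤ K := fun f hf => hf.1
  have hsup' : InSup K' := by
    rintro _ ⟨g, rfl⟩
    exact ⟨hsup.mulRight_mem g, χ g, fun x => hmul x g⟩
  have hstab : ∀ k ∈ K', k 1 = 1 → ∀ x, χ (k x) = χ x := by
    rintro k ⟨_, a, ha⟩ h1 x
    have := ha 1
    rw [h1, left_eq_add] at this
    rw [ha, this, add_zero]
  have hmin : K' = K := by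
    refine hK.2 K' ⟨hsup', Set.Subset.antisymm ?_ ?_⟩ ⟨hK'K, ?_⟩
    · rintro f hf _ ⟨g, rfl⟩
      exact map_image_rel_iff.2 (hsup'.mem_orbit_iff hf g)
    · intro f hf
      have hf' : ∀ x y, ∃ k ∈ K', k 1 = 1 ∧ k (y * x⁻¹) = f y * (f x)⁻¹ := fun x y =>
        mem_orbit_stabilizer_iff.1 ((map_image_rel_iff.1 (hf _ ⟨y * x⁻¹, rfl⟩) x y).2
          (MulAction.mem_orbit_self _))
      refine ⟨?_, χ (f 1), fun x => ?_⟩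
      · rw [← SetLike.mem_coe, hK.1.2]
        rintro _ ⟨g, rfl⟩
        refine map_image_rel_iff.2 fun x y => ?_
        obtain ⟨k, hk, h1, h2⟩ := hf' x y
        have := hsup.mem_orbit_iff (hK'K hk) g 1 (y * x⁻¹)
        rwa [h1, h2, inv_one, mul_one, mul_one] at this
      · obtain ⟨k, hk, h1, h2⟩ := hf' 1 x
        have := hstab k hk h1 (x * 1⁻¹)
        rw [h2] at this
        simp only [hmul, hinv, hone] at this
        rw [neg_zero, add_zero] at this
        rw [← this]
        ring
    · intro R hRK hreg ⟨e⟩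
      let r : G → K := fun g => ⟨(e.symm g : Equiv.Perm G), hRK (e.symm g).2⟩
      have hr : ∀ g h, r (g * h) = r g * r h := fun g h => by
        ext1; simp [r]
      have hr1 : r 1 = 1 := by ext1; simp [r]
      have hrpow : ∀ g (n : ℕ), r (g ^ n) = r g ^ n := fun g n => by
        induction n with
        | zero => simpa using hr1
        | succ n ih => rw [pow_succ, pow_succ, hr, ih]
      have htrans : ∀ a b : ZMod 4, ∃ g, φ (r g) a = b := fun a b => by
        obtain ⟨f, hf, -⟩ := hreg (c ^ a.val) (c ^ b.val)
        refine ⟨e f, ?_⟩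
        have := hφ (r (e f)) (c ^ a.val)
        simp only [r, MulEquiv.symm_apply_apply, hf, hlift] at this
        simpa [r] using this.symm
      have hrH : ∀ h ∈ H, φ (r h) = 1 := by
        intro h hh
        have : Fact p.Prime := ⟨F.prime⟩
        have hp4 : ¬ p ∣ Fintype.card (ZMod 4) := by
          rw [ZMod.card, show 4 = 2 ^ 2 by rfl]
          intro hd
          have := (Nat.prime_dvd_prime_iff_eq F.prime Nat.prime_two).1 (F.prime.dvd_of_dvd_pow hd)
          have h2 := F.odd
          rw [this] at h2
          exact absurd h2 (by decide)
        obtain ⟨a, ha⟩ := Equiv.Perm.exists_fixed_point_of_prime (p := p) (n := 1)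
          hp4 (σ := φ (r h)) (by
            rw [pow_one, ← map_pow, ← hrpow, F.pow_eq_one h hh, hr1, map_one])
        ext1 b
        obtain ⟨g, rfl⟩ := htrans a b
        rw [← Equiv.Perm.mul_apply, ← map_mul, ← hr, mul_comm, hr, map_mul,
          Equiv.Perm.mul_apply, ha, Equiv.Perm.one_apply]
      have hrφ : ∀ (i : ℕ), ∀ h ∈ H, φ (r (c ^ i * h)) = φ (r c) ^ i := fun i h hh => by
        rw [hr, map_mul, hrH h hh, mul_one, hrpow, map_pow]
      obtain ⟨i, j, a, ha⟩ := exists_conj_four_cycle (φ (r c)).injective fun j => by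
        obtain ⟨g, hg⟩ := htrans 0 j
        obtain ⟨n, h, hh, rfl⟩ := F.exists_pow_mul g
        refine ⟨⟨n % 4, Nat.mod_lt _ (by norm_num)⟩, ?_⟩
        rw [hrφ n h hh, pow_eq_pow_mod n (n := 4)] at hg
        · rw [Equiv.Perm.iterate_eq_pow]
          exact hg
        · rw [← map_pow, ← hrpow, F.pow_four, hr1, map_one]
      let k : K := r c ^ (i : ℕ) * ⟨Equiv.mulRight (c ^ (j : ℕ)), hsup.mulRight_mem _⟩
      have hk : ∀ x, φ k x = (φ (r c))^[i] (x + (j : ℕ)) := fun x => by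
        rw [map_mul, map_pow, Equiv.Perm.mul_apply, Equiv.Perm.iterate_eq_pow]
        congr 1
        rw [← hlift x, ← hφ]
        simp [hmul, hpow, hc]
      refine ⟨k, k.2, fun f hf => ⟨K.mul_mem (K.mul_mem k.2 (hRK hf)) (K.inv_mem k.2), ?_⟩⟩
      obtain ⟨n, h, hh, hn⟩ := F.exists_pow_mul (e ⟨f, hf⟩)
      have hf' : (⟨f, hRK hf⟩ : K) = r (c ^ n * h) := by
        ext1; simp [r, ← hn]
      have hconj : ∀ (n : ℕ) x, φ k ((φ (r c) ^ n) x) = φ k x + n * a := fun n x => by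
        induction n with
        | zero => simp
        | succ n ih =>
          rw [pow_succ', Equiv.Perm.mul_apply, hk, ha, ← hk, ih]
          push_cast
          ring
      refine ⟨n * a, fun x => ?_⟩
      have h1 := hφ (k * (⟨f, hRK hf⟩ : K) * k⁻¹) x
      rw [hf', map_mul, map_mul, hrφ n h hh, Equiv.Perm.mul_apply, Equiv.Perm.mul_apply, hconj,
        map_inv, ← Equiv.Perm.mul_apply (φ k), mul_inv_cancel, Equiv.Perm.one_apply, ← hf'] at h1
      exact h1
  rw [hcell] at hx
  obtain ⟨k, hk, h1, rfl⟩ := mem_orbit_stabilizer_iff.1 hx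
  rw [← hχ]
  exact hstab k (hmin ▸ hk) h1 g
lemma mem_stabilizer_set_iff {G : Type*} [Group G] [Finite G] {X : Set G} {g : G} :
    g ∈ MulAction.stabilizer G X ↔ ∀ x ∈ X, g * x ∈ X :=
  MulAction.mem_stabilizer_set' X.toFinite

lemma subset_rad {G : Type*} [CommGroup G] [Finite G] {X : Set G} {L : Subgroup G}
    (h : L ≤ MulAction.stabilizer G X) : (L : Set G) ⊆ rad X := by
  intro l hl
  have h1 : {l} * X = X := by
    rw [Set.singleton_mul]
    exact MulAction.mem_stabilizer_iff.1 (h hl)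
  exact ⟨h1, by rw [mul_comm, h1]⟩

lemma le_of_setOrbits_eq {G : Type*} [Group G] [IsCyclic G] {K M : Subgroup (MulAut G)}
    (h : setOrbits (K : Set (MulAut G)) = setOrbits (M : Set (MulAut G))) : K ≤ M := by
  obtain ⟨s, hs⟩ := IsCyclic.exists_generator (α := G)
  intro k hk
  have h1 : (fun φ : MulAut G => φ s) '' (K : Set (MulAut G)) ∈
      setOrbits (M : Set (MulAut G)) := h ▸ ⟨s, rfl⟩
  obtain ⟨g, hg⟩ := h1
  have h2 : s ∈ (fun φ : MulAut G => φ g) '' (M : Set (MulAut G)) := by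
    simp only [hg]
    exact ⟨1, K.one_mem, rfl⟩
  have h3 : k s ∈ (fun φ : MulAut G => φ g) '' (M : Set (MulAut G)) := by
    simp only [hg]
    exact ⟨k, hk, rfl⟩
  obtain ⟨m, hm, hms⟩ := h2
  obtain ⟨n, hn, hns⟩ := h3
  have h4 : k = n * m⁻¹ := by
    ext x
    obtain ⟨i, rfl⟩ := hs x
    have : (n * m⁻¹) s = k s := by
      rw [MulAut.mul_apply, ← hns]
      congr 1
      rw [← hms, MulAut.inv_apply_self]
    simp only [map_zpow, this]
  exact h4 ▸ M.mul_mem hn (M.inv_mem hm)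

namespace SRing

section Group

variable {G : Type*} [Group G] [Finite G] {A : SRing G}

lemma IsASet.stabilizer {X : Set G} (hX : A.IsASet X) :
    A.IsASubgroup (MulAction.stabilizer G X) := by
  change A.IsASet _
  convert hX.transporter hX using 1
  ext g
  exact mem_stabilizer_set_iff

lemma ne_one_of_mem_cell {g x : G} (hg : g ≠ 1) (hx : x ∈ A.cell g) : x ≠ 1 := by
  rintro rfl
  have := A.mem_cell_comm hx
  rw [A.cell_one] at this
  exact hg this

lemma basic_eq_singletons_of_card_le_two (h : Nat.card G ≤ 2) :
    A.basic = Set.range fun s => ({s} : Set G) := by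
  have hcell : ∀ g, A.cell g = {g} := by
    intro g
    by_cases hg : g = 1
    · rw [hg, A.cell_one]
    refine Set.Subset.antisymm (fun x hx => ?_) (by simpa using A.mem_cell g)
    by_contra hxg
    have hx1 := A.ne_one_of_mem_cell hg hx
    have : ({1, g, x} : Set G).ncard = 3 :=
      Set.ncard_eq_three.2 ⟨1, g, x, Ne.symm hg, hx1.symm, Ne.symm hxg, rfl⟩
    have h2 := Set.ncard_le_card ({1, g, x} : Set G)
    omega
  ext X
  constructor
  · intro hX
    obtain ⟨g, hg⟩ := A.nonempty X hX
    exact ⟨g, by rw [A.eq_cell hX hg, hcell]⟩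
  · rintro ⟨g, rfl⟩
    simpa only [hcell] using A.cell_mem_basic g

lemma ncard_basic_eq_two (h : ∀ g x : G, g ≠ 1 → x ≠ 1 → x ∈ A.cell g) {a : G} (ha : a ≠ 1) :
    A.basic.ncard = 2 := by
  have : A.basic = {{1}, A.cell a} := by
    ext X
    simp only [Set.mem_insert_iff, Set.mem_singleton_iff]
    constructor
    · intro hX
      obtain ⟨g, hg⟩ := A.nonempty X hX
      rw [A.eq_cell hX hg]
      by_cases hg1 : g = 1
      · rw [hg1]; exact Or.inl A.cell_one
      · exact Or.inr (A.cell_eq_of_mem (h a g ha hg1))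
    · rintro (rfl | rfl)
      · exact A.one_mem
      · exact A.cell_mem_basic a
  rw [this, Set.ncard_pair]
  rw [← A.cell_one]
  intro he
  have := A.mem_cell a
  rw [← he, A.cell_one] at this
  exact ha this

lemma mem_cell_mul {d g x : G} (hd : A.IsASet {d}) :
    d * x ∈ A.cell (d * g) ↔ x ∈ A.cell g := by
  have aux : ∀ {d g x : G}, A.IsASet {d} → d * x ∈ A.cell (d * g) → x ∈ A.cell g := by
    intro d g x hd hx
    have := (hd.mul (IsASet.cell g)).cell_subset
      (Set.mul_mem_mul (Set.mem_singleton d) (A.mem_cell g)) hx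
    simpa using this
  refine ⟨aux hd, fun hx => aux (d := d⁻¹) ?_ ?_⟩
  · simpa using hd.inv
  · simpa using hx

lemma mem_autGSet_iff {φ : MulAut G} :
    φ ∈ A.autGSet ↔ ∀ X ∈ A.basic, ∀ g, φ g ∈ X ↔ g ∈ X := by
  refine forall₂_congr fun X _ => map_image_rel_iff.trans ⟨fun h g => ?_, fun h x y => ?_⟩
  · simpa using h 1 g
  · change φ y * (φ x)⁻¹ ∈ X ↔ _
    rw [← h (y * x⁻¹), map_mul, map_inv]

variable (A) in
/-- `Aut_G(𝒜)` as a subgroup of `Aut(G)`. -/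
def autG : Subgroup (MulAut G) where
  carrier := A.autGSet
  one_mem' := mem_autGSet_iff.2 fun _ _ _ => Iff.rfl
  mul_mem' := fun {φ ψ} hφ hψ => mem_autGSet_iff.2 fun X hX g =>
    (mem_autGSet_iff.1 hφ X hX (ψ g)).trans (mem_autGSet_iff.1 hψ X hX g)
  inv_mem' := fun {φ} hφ => mem_autGSet_iff.2 fun X hX g => by
    rw [← mem_autGSet_iff.1 hφ X hX, MulAut.apply_inv_self]

lemma isCayleyMinimal_of_isCyclic [IsCyclic G] : A.IsCayleyMinimal := fun K hK => by
  have h : setOrbits (K : Set (MulAut G)) = setOrbits (A.autG : Set (MulAut G)) := hK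
  exact congrArg _ (le_antisymm (le_of_setOrbits_eq h) (le_of_setOrbits_eq h.symm))

lemma IsASet.restrict {U : Subgroup G} {AU : SRing U} (hAU : AU.basic = restrictBasic A U)
    {X : Set G} (hX : A.IsASet X) : AU.IsASet (Subtype.val ⁻¹' X) := by
  refine AU.isASet_iff.2 fun g hg x hx => ?_
  have h1 : Subtype.val '' AU.cell g ∈ A.basic := by
    have := AU.cell_mem_basic g
    rwa [hAU] at this
  exact hX.basic_subset h1 ⟨g, AU.mem_cell g, rfl⟩ hg ⟨x, hx, rfl⟩

end Group

section CommGroup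

variable {G : Type*} [CommGroup G] [Finite G] {A : SRing G}

lemma IsASubgroup.sup {U V : Subgroup G} (hU : A.IsASubgroup U) (hV : A.IsASubgroup V) :
    A.IsASubgroup (U ⊔ V) := by
  have := IsASet.mul hU hV
  rwa [← Subgroup.mul_normal] at this

lemma IsASet.quot {L : Subgroup G} (hL : A.IsASubgroup L) {AQ : SRing (G ⧸ L)}
    (hAQ : AQ.basic = quotBasic A L) {X : Set G} (hX : A.IsASet X) :
    AQ.IsASet (QuotientGroup.mk '' X) := by
  refine AQ.isASet_iff.2 ?_
  rintro _ ⟨x, hx, rfl⟩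
  obtain ⟨Y, hY, hYc⟩ : AQ.cell (x : G ⧸ L) ∈ quotBasic A L := hAQ ▸ AQ.cell_mem_basic _
  have h1 : (x : G ⧸ L) ∈ QuotientGroup.mk '' Y := by
    have := AQ.mem_cell (x : G ⧸ L)
    rwa [← hYc] at this
  obtain ⟨y, hy, hyx⟩ := h1
  have h2 : Y ⊆ X * (L : Set G) := by
    refine (hX.mul hL).basic_subset hY hy ⟨x, hx, x⁻¹ * y, ?_, by simp⟩
    exact QuotientGroup.eq.1 hyx.symm
  rw [← hYc]
  rintro _ ⟨w, hw, rfl⟩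
  obtain ⟨v, hv, l, hl, rfl⟩ := h2 hw
  exact ⟨v, hv, QuotientGroup.eq.2 (by simpa using hl)⟩

end CommGroup

end SRing

namespace SRing

variable {G : Type*} [CommGroup G] [Finite G] {A : SRing G}

/-- An S-ring over `D × E` with `|E|` prime and `|D|` coprime to `|E|`, which is discrete on `D`
and has `E` as an `𝒜`-subgroup, is cyclotomic. -/
lemma isCyclotomic_of_prime_compl {q : ℕ} (hq : q.Prime) {D E : Subgroup G} (hsup : D ⊔ E = ⊤)
    (hE : Nat.card E = q) (hD : (Nat.card D).Coprime q) (hDA : ∀ d ∈ D, A.IsASet {d})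
    (hEA : A.IsASubgroup E) : A.IsCyclotomic := by
  have hcard : ∀ m : ℕ, m.Coprime (Nat.card D) → m.Coprime q → m.Coprime (Nat.card G) := by
    intro m h1 h2
    have hd : Nat.card G ∣ Nat.card D * q := by
      have hf : Function.Surjective (fun x : D × E => (x.1 : G) * x.2) := by
        intro g
        obtain ⟨d, hd, e, he, rfl⟩ := Subgroup.mem_sup.1 (hsup ▸ Subgroup.mem_top g : g ∈ D ⊔ E)
        exact ⟨(⟨d, hd⟩, ⟨e, he⟩), rfl⟩
      have := Subgroup.card_dvd_of_surjective
        (D.subtype.coprod E.subtype) (fun g => hf g)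
      rwa [Nat.card_prod, hE] at this
    exact Nat.Coprime.of_dvd_right hd (Nat.Coprime.mul_right h1 h2)
  have hdec : ∀ g : G, ∃ d ∈ D, ∃ e ∈ E, g = d * e := fun g => by
    obtain ⟨d, hd, e, he, rfl⟩ := Subgroup.mem_sup.1 (hsup ▸ Subgroup.mem_top g : g ∈ D ⊔ E)
    exact ⟨d, hd, e, he, rfl⟩
  have hpowE : ∀ e ∈ E, e ^ q = 1 := fun e he => 
    hE ▸ congrArg Subtype.val (pow_card_eq_one' (x := (⟨e, he⟩ : E)))
  have hpowD : ∀ d ∈ D, d ^ Nat.card D = 1 := fun d hd => 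
    congrArg Subtype.val (pow_card_eq_one' (x := (⟨d, hd⟩ : D)))
  have hgen : ∀ e ∈ E, e ≠ 1 → ∀ x ∈ E, ∃ k : ℕ, x = e ^ k := by
    intro e he he1 x hx
    have : Fact q.Prime := ⟨hq⟩
    have h1 := mem_powers_of_prime_card (G := E) (g := ⟨e, he⟩) (g' := ⟨x, hx⟩) hE
      (fun h => he1 (congrArg Subtype.val h))
    obtain ⟨k, hk⟩ := h1
    exact ⟨k, (congrArg Subtype.val hk).symm⟩
  have hexp : ∀ k : ℕ, ∃ m : ℕ, (∀ d ∈ D, d ^ m = d) ∧ (∀ e ∈ E, e ^ m = e ^ k) ∧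
      (¬ q ∣ k → m.Coprime (Nat.card G)) := by
    intro k
    obtain ⟨m, hm1, hm2⟩ := Nat.chineseRemainder hD 1 k
    refine ⟨m, fun d hd => ?_, fun e he => pow_eq_pow_of_modEq hm2 (hpowE e he), fun hk => ?_⟩
    · simpa using pow_eq_pow_of_modEq hm1 (hpowD d hd)
    · refine hcard m ?_ ?_
      · rw [Nat.Coprime, hm1.gcd_eq, Nat.gcd_one_left]
      · rw [Nat.Coprime, hm2.gcd_eq]
        exact Nat.Coprime.symm ((Nat.Prime.coprime_iff_not_dvd hq).2 hk)
  refine ⟨A.autG, ?_⟩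
  have horb : ∀ g, (fun φ : MulAut G => φ g) '' (A.autG : Set (MulAut G)) = A.cell g := by
    intro g
    refine Set.Subset.antisymm ?_ ?_
    · rintro _ ⟨φ, hφ, rfl⟩
      exact (mem_autGSet_iff.1 hφ _ (A.cell_mem_basic g) g).2 (A.mem_cell g)
    · intro x hx
      obtain ⟨d, hd, e, he, rfl⟩ := hdec g
      obtain ⟨e', he', rfl⟩ : ∃ e' ∈ E, x = d * e' := by
        have := ((hDA d hd).mul hEA).cell_subset (Set.mul_mem_mul rfl he) hx
        obtain ⟨_, rfl, e', he', rfl⟩ := this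
        exact ⟨e', he', rfl⟩
      rw [mem_cell_mul (hDA d hd)] at hx
      by_cases he1 : e = 1
      · rw [he1, A.cell_one] at hx
        exact ⟨1, A.autG.one_mem, by rw [Set.mem_singleton_iff.1 hx, he1]; rfl⟩
      have he1' := A.ne_one_of_mem_cell he1 hx
      obtain ⟨k, rfl⟩ := hgen e he he1 e' he'
      have hqk : ¬ q ∣ k := by
        rintro ⟨j, rfl⟩
        exact he1' (by rw [pow_mul, hpowE e he, one_pow])
      obtain ⟨m, hmD, hmE, hm⟩ := hexp k
      have hbij : Function.Bijective (powMonoidHom m : G →* G) :=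
        (powCoprime (hm hqk).symm).bijective
      have hpres : ∀ g, g ^ m ∈ A.cell g := by
        intro g
        obtain ⟨d₁, hd₁, e₁, he₁, rfl⟩ := hdec g
        rw [mul_pow, hmD d₁ hd₁, mem_cell_mul (hDA d₁ hd₁)]
        by_cases he₁1 : e₁ = 1
        · simp [he₁1, A.mem_cell]
        obtain ⟨j, rfl⟩ := hgen e he he1 e₁ he₁
        have hqj : ¬ q ∣ j := by
          rintro ⟨i, rfl⟩
          exact he₁1 (by rw [pow_mul, hpowE e he, one_pow])
        obtain ⟨n, -, hnE, hn⟩ := hexp j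
        rw [← hnE e he, ← pow_cell (hn hqj)]
        refine ⟨e ^ m, ?_, by simp only [← pow_mul, mul_comm]⟩
        rwa [hmE e he]
      refine ⟨MulEquiv.ofBijective (powMonoidHom m : G →* G) hbij, ?_, ?_⟩
      · refine mem_autGSet_iff.2 fun X hX y => ?_
        change y ^ m ∈ X ↔ y ∈ X
        constructor
        · intro hy
          rw [A.eq_cell hX hy]
          exact A.mem_cell_comm (hpres y)
        · intro hy
          rw [A.eq_cell hX hy]
          exact hpres y
      · change (d * e) ^ m = d * e ^ k
        rw [mul_pow, hmD d hd, hmE e he]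
  ext X
  constructor
  · intro hX
    obtain ⟨g, hg⟩ := A.nonempty X hX
    exact ⟨g, (horb g).trans (A.eq_cell hX hg).symm⟩
  · rintro ⟨g, rfl⟩
    simpa only [horb] using A.cell_mem_basic g

end SRing

namespace Frame

variable {G : Type*} [CommGroup G] {p : ℕ} {c : G} {H : Subgroup G}

lemma mul_rules (F : Frame p c H) : (∀ h, c * (c * h) = c ^ 2 * h) ∧
    (∀ h, c * (c ^ 2 * h) = c ^ 3 * h) ∧ (∀ h, c * (c ^ 3 * h) = h) ∧
    (∀ h, c ^ 2 * (c * h) = c ^ 3 * h) ∧ (∀ h, c ^ 2 * (c ^ 2 * h) = h) ∧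
    (∀ h, c ^ 2 * (c ^ 3 * h) = c * h) ∧ (∀ h, c ^ 3 * (c * h) = h) ∧
    (∀ h, c ^ 3 * (c ^ 2 * h) = c * h) ∧ (∀ h, c ^ 3 * (c ^ 3 * h) = c ^ 2 * h) := by
  have h5 : c ^ 5 = c := by rw [pow_succ, F.pow_four, one_mul]
  have h6 : c ^ 6 = c ^ 2 := by rw [show 6 = 4 + 2 by rfl, pow_add, F.pow_four, one_mul]
  refine ⟨?_, ?_, ?_, ?_, ?_, ?_, ?_, ?_, ?_⟩ <;> intro h <;>
    simp only [← mul_assoc, ← pow_succ, ← pow_succ', ← pow_add, ← pow_two, ← pow_mul, F.pow_four,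
      one_mul, Nat.reduceAdd, Nat.reduceMul, Nat.reducePow, h5, h6]

lemma decomp (F : Frame p c H) (g : G) :
    ∃ h ∈ H, g = h ∨ g = c * h ∨ g = c ^ 2 * h ∨ g = c ^ 3 * h := by
  obtain ⟨i, h, hh, rfl⟩ := F.exists_pow_mul g
  refine ⟨h, hh, ?_⟩
  rw [pow_eq_pow_mod i F.pow_four]
  have : i % 4 < 4 := Nat.mod_lt _ (by norm_num)
  interval_cases i % 4 <;> simp

lemma mul_notMem (F : Frame p c H) {h : G} (hh : h ∈ H) :
    c * h ∉ H ∧ c ^ 2 * h ∉ H ∧ c ^ 3 * h ∉ H := by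
  simp only [H.mul_mem_cancel_right hh]
  exact ⟨F.notMem, F.sq_notMem, F.pow_three_notMem⟩

lemma inv_eq (F : Frame p c H) : c⁻¹ = c ^ 3 :=
  inv_eq_of_mul_eq_one_right (by rw [← pow_succ']; exact F.pow_four)

lemma inv_sq (F : Frame p c H) : c⁻¹ ^ 2 = c ^ 2 := by
  rw [F.inv_eq]
  simpa [← pow_two] using F.mul_rules.2.2.2.2.2.2.2.2 1

lemma inv_cube (F : Frame p c H) : c⁻¹ ^ 3 = c := by
  rw [pow_succ, F.inv_sq, F.inv_eq]
  simpa using F.mul_rules.2.2.2.2.2.1 1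

lemma inv (F : Frame p c H) : Frame p c⁻¹ H where
  prime := F.prime
  odd := F.odd
  pow_four := by rw [inv_pow, F.pow_four, inv_one]
  sq_notMem := F.inv_sq ▸ F.sq_notMem
  pow_eq_one := F.pow_eq_one
  exists_pow_mul g := by
    obtain ⟨i, h, hh, rfl⟩ := F.exists_pow_mul g
    exact ⟨3 * i, h, hh, by rw [pow_mul, F.inv_cube]⟩
  card := F.card

lemma coprime_four (F : Frame p c H) : Nat.Coprime 4 p := by
  rw [show 4 = 2 ^ 2 by rfl]
  exact Nat.Coprime.pow_left 2 (Nat.coprime_two_left.2 F.odd)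

lemma finite_H (F : Frame p c H) : Finite H :=
  Nat.finite_of_card_ne_zero (F.card ▸ pow_ne_zero _ F.prime.ne_zero)

lemma card_dvd (F : Frame p c H) : Nat.card G ∣ 4 * p ^ 2 := by
  have h1 : Nat.card G ∣ Nat.card (Subgroup.zpowers c × H) := by
    refine Subgroup.card_dvd_of_surjective ((Subgroup.zpowers c).subtype.coprod H.subtype)
      fun g => ?_
    obtain ⟨i, h, hh, rfl⟩ := F.exists_pow_mul g
    exact ⟨(⟨c ^ i, Subgroup.npow_mem_zpowers c i⟩, ⟨h, hh⟩), rfl⟩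
  rw [Nat.card_prod, F.card, Nat.card_zpowers] at h1
  exact h1.trans (mul_dvd_mul_right (orderOf_dvd_of_pow_eq_one F.pow_four) _)

/-- Powers acting independently on the two factors. -/
lemma exists_pow (F : Frame p c H) (a k : ℕ) : ∃ m : ℕ, c ^ m = c ^ a ∧
    (∀ h ∈ H, h ^ m = h ^ k) ∧ (Odd a → ¬ p ∣ k → m.Coprime (Nat.card G)) := by
  obtain ⟨m, hm1, hm2⟩ := Nat.chineseRemainder F.coprime_four a k
  refine ⟨m, pow_eq_pow_of_modEq hm1 F.pow_four,
    fun h hh => pow_eq_pow_of_modEq hm2 (F.pow_eq_one h hh), fun ha hk => ?_⟩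
  refine Nat.Coprime.of_dvd_right F.card_dvd (Nat.Coprime.mul_right ?_ (.pow_right 2 ?_))
  · rw [Nat.Coprime, hm1.gcd_eq, ← Nat.Coprime, show 4 = 2 ^ 2 by rfl]
    exact Nat.Coprime.pow_right 2 (Nat.coprime_two_right.2 ha)
  · rw [Nat.Coprime, hm2.gcd_eq]
    exact Nat.Coprime.symm ((Nat.Prime.coprime_iff_not_dvd F.prime).2 hk)

lemma card_eq (F : Frame p c H) {R : Subgroup G} (hR : R ≤ H) (h1 : R ≠ ⊥) (h2 : R ≠ H) :
    Nat.card R = p := by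
  have := F.finite_H
  have hd : Nat.card R ∣ p ^ 2 := F.card ▸ Subgroup.card_dvd_of_le hR
  obtain ⟨k, hk, hRk⟩ := (Nat.dvd_prime_pow F.prime).1 hd
  interval_cases k
  · rw [pow_zero, Subgroup.card_eq_one] at hRk
    exact absurd hRk h1
  · simpa using hRk
  · exact absurd (Subgroup.eq_of_le_of_card_ge hR (by rw [F.card, hRk])) h2

lemma sup_eq (F : Frame p c H) {R V : Subgroup G} (hR : R ≤ H) (h1 : R ≠ ⊥) (hV : V ≤ H)
    (h2 : ¬ V ≤ R) : R ⊔ V = H := by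
  have := F.finite_H
  by_contra hne
  have h3 : Nat.card R = p := F.card_eq hR h1 (by rintro rfl; exact h2 hV)
  have h4 : Nat.card (R ⊔ V : Subgroup G) = p :=
    F.card_eq (sup_le hR hV) (fun h => h1 (le_bot_iff.1 (h ▸ le_sup_left))) hne
  have : Finite (R ⊔ V : Subgroup G) := Nat.finite_of_card_ne_zero (h4 ▸ F.prime.ne_zero)
  have h5 := Subgroup.eq_of_le_of_card_ge (le_sup_left : R ≤ R ⊔ V) (by rw [h3, h4])
  exact h2 (h5 ▸ le_sup_right)

end Frame

lemma exists_pow_of_card_eq_prime {G : Type*} [Group G] {q : ℕ} (hq : q.Prime) {E : Subgroup G}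
    (hE : Nat.card E = q) {e x : G} (he : e ∈ E) (he1 : e ≠ 1) (hx : x ∈ E) :
    ∃ k : ℕ, x = e ^ k := by
  have : Fact q.Prime := ⟨hq⟩
  obtain ⟨k, hk⟩ := mem_powers_of_prime_card (G := E) (g := ⟨e, he⟩) (g' := ⟨x, hx⟩) hE
    (fun h => he1 (congrArg Subtype.val h))
  exact ⟨k, (congrArg Subtype.val hk).symm⟩

lemma card_eq_of_pow {G : Type*} [Group G] {q : ℕ} (hq : q.Prime) {E : Subgroup G} {e : G}
    (he : e ∈ E) (he1 : e ≠ 1) (heq : e ^ q = 1) (h : ∀ x ∈ E, ∃ k : ℕ, x = e ^ k) :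
    Nat.card E = q := by
  have : Fact q.Prime := ⟨hq⟩
  have hE : E = Subgroup.zpowers e := le_antisymm
    (fun x hx => by obtain ⟨k, rfl⟩ := h x hx; exact Subgroup.npow_mem_zpowers e k)
    (Subgroup.zpowers_le.2 he)
  rw [hE, Nat.card_zpowers, orderOf_eq_prime heq he1]

lemma isCyclic_section {G : Type*} [CommGroup G] {U L : Subgroup G} {g : G} (hg : g ∈ U)
    (h : ∀ u ∈ U, ∃ n : ℕ, ∃ l ∈ L, u = g ^ n * l) : IsCyclic (U ⧸ L.subgroupOf U) := by
  refine ⟨⟨QuotientGroup.mk ⟨g, hg⟩, fun x => ?_⟩⟩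
  obtain ⟨⟨u, hu⟩, rfl⟩ := QuotientGroup.mk_surjective x
  obtain ⟨n, l, hl, hul⟩ := h u hu
  refine ⟨n, ?_⟩
  simp only [zpow_natCast]
  rw [← QuotientGroup.mk_pow, QuotientGroup.eq, Subgroup.mem_subgroupOf]
  simpa [hul] using hl

lemma condCA_of_relIndex {G : Type*} [CommGroup G] [Finite G] {A : SRing G} {U L : Subgroup G}
    (h : L.relIndex U ≤ 2) : CondCA A U L := fun _ _ =>
  SRing.basic_eq_singletons_of_card_le_two h

lemma condCA_self {G : Type*} [CommGroup G] [Finite G] {A : SRing G} {U : Subgroup G} :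
    CondCA A U U := condCA_of_relIndex (by simp)

namespace SRing

variable {G : Type*} [CommGroup G] [Finite G] {A : SRing G}

variable (A) in
/-- The largest `𝒜`-subgroup contained in `H`. -/
def core (H : Subgroup G) : Subgroup G where
  carrier := {h | A.cell h ⊆ H}
  one_mem' := by
    rw [Set.mem_ofPred_eq, A.cell_one]
    simp
  mul_mem' := fun {a b} ha hb => by
    have := ((IsASet.cell a).mul (IsASet.cell b)).cell_subset
      (Set.mul_mem_mul (A.mem_cell a) (A.mem_cell b))
    refine this.trans ?_
    rintro _ ⟨x, hx, y, hy, rfl⟩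
    exact H.mul_mem (ha hx) (hb hy)
  inv_mem' := fun {a} ha => by
    have := (IsASet.cell a).inv.cell_subset (Set.inv_mem_inv.2 (A.mem_cell a))
    exact this.trans fun x hx => H.inv_mem_iff.1 (ha hx)

lemma core_le (H : Subgroup G) : A.core H ≤ H := fun h hh => hh (A.mem_cell h)

lemma IsASet.subset_core {H : Subgroup G} {X : Set G} (hX : A.IsASet X) (h : X ⊆ H) :
    X ⊆ A.core H := fun _ hx => (hX.cell_subset hx).trans h

lemma isASubgroup_core (H : Subgroup G) : A.IsASubgroup (A.core H) :=
  A.isASet_iff.2 fun _ hg => (IsASet.cell _).subset_core hg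

end SRing

/-- The elements over which the map `c ^ i * h ↦ c ^ (2 * i) * h` has an odd number of
preimages in `X`. -/
def oddFibre {G : Type*} [CommGroup G] (c : G) (H : Subgroup G) (X : Set G) : Set G :=
  {g | (g ∈ H ∧ ¬ (g ∈ X ↔ c ^ 2 * g ∈ X)) ∨ (c ^ 2 * g ∈ H ∧ ¬ (c * g ∈ X ↔ c ^ 3 * g ∈ X))}

lemma not_two_dvd_ncard_pair {α : Type*} {X : Set α} {a b : α} (hab : a ≠ b) :
    ¬ 2 ∣ {x | x ∈ X ∧ (x = a ∨ x = b)}.ncard ↔ ¬ (a ∈ X ↔ b ∈ X) := by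
  by_cases ha : a ∈ X <;> by_cases hb : b ∈ X
  · have : {x | x ∈ X ∧ (x = a ∨ x = b)} = {a, b} := by ext x; simp; aesop
    simp [this, Set.ncard_pair hab, ha, hb]
  · have : {x | x ∈ X ∧ (x = a ∨ x = b)} = {a} := by ext x; simp; aesop
    simp [this, ha, hb]
  · have : {x | x ∈ X ∧ (x = a ∨ x = b)} = {b} := by ext x; simp; aesop
    simp [this, ha, hb]
  · have : {x | x ∈ X ∧ (x = a ∨ x = b)} = ∅ := by ext x; simp; aesop
    simp [this, ha, hb]

namespace Frame

variable {G : Type*} [CommGroup G] {p : ℕ} {c : G} {H : Subgroup G} {X : Set G}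

lemma mem_oddFibre (F : Frame p c H) {h : G} (hh : h ∈ H) :
    h ∈ oddFibre c H X ↔ ¬ (h ∈ X ↔ c ^ 2 * h ∈ X) := by
  simp [oddFibre, hh, (F.mul_notMem hh).2.1]

lemma sq_mul_mem_oddFibre (F : Frame p c H) {h : G} (hh : h ∈ H) :
    c ^ 2 * h ∈ oddFibre c H X ↔ ¬ (c * h ∈ X ↔ c ^ 3 * h ∈ X) := by
  obtain ⟨h1, h2, h3, h4, h5, h6, h7, h8, h9⟩ := F.mul_rules
  simp only [oddFibre, Set.mem_ofPred_eq, (F.mul_notMem hh).2.1, false_and, false_or, h2, h5, h8,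
    hh, true_and]
  tauto

lemma mul_notMem_oddFibre (F : Frame p c H) {h : G} (hh : h ∈ H) :
    c * h ∉ oddFibre c H X ∧ c ^ 3 * h ∉ oddFibre c H X := by
  obtain ⟨h1, h2, h3, h4, h5, h6, h7, h8, h9⟩ := F.mul_rules
  have := F.mul_notMem hh
  constructor <;> simp [oddFibre, this, h4, h6]

end Frame

namespace SRing.IsASet

variable {G : Type*} [CommGroup G] [Finite G] {A : SRing G} {p : ℕ} {c : G} {H : Subgroup G}
  {X : Set G}

lemma oddFibre (F : Frame p c H) (hX : A.IsASet X) : A.IsASet (oddFibre c H X) := by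
  obtain ⟨r1, r2, r3, r4, r5, r6, r7, r8, r9⟩ := F.mul_rules
  obtain ⟨n, hn⟩ := F.odd
  have hp : p.Prime := F.prime
  obtain ⟨j, hjc, hjH, hj⟩ := F.exists_pow 1 (n + 1)
  specialize hj odd_one (fun hd => by
    have h1 : p ∣ 2 * (n + 1) := hd.mul_left 2
    rw [show 2 * (n + 1) = p + 1 by omega] at h1
    exact hp.one_lt.ne' (Nat.dvd_one.1 ((Nat.dvd_add_right dvd_rfl).1 h1)))
  have hjH' : ∀ h ∈ H, (h ^ 2) ^ j = h := fun h hh => by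
    rw [hjH _ (H.pow_mem hh 2), ← pow_mul, show 2 * (n + 1) = p + 1 by omega, pow_succ,
      F.pow_eq_one h hh, one_mul]
  rw [pow_one] at hjc
  have hz : (c ^ 2) ^ j = c ^ 2 := by rw [← pow_mul, mul_comm, pow_mul, hjc]
  have hbij : Function.Bijective (fun x : G => x ^ j) := (powCoprime hj.symm).bijective
  have t0 : ∀ h ∈ H, (h ^ 2) ^ j = h := hjH'
  have t1 : ∀ h ∈ H, ((c * h) ^ 2) ^ j = c ^ 2 * h := fun h hh => by
    rw [mul_pow, mul_pow, hz, hjH' h hh]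
  have t2 : ∀ h ∈ H, ((c ^ 2 * h) ^ 2) ^ j = h := fun h hh => by
    rw [mul_pow, ← pow_mul, F.pow_four, one_mul, hjH' h hh]
  have t3 : ∀ h ∈ H, ((c ^ 3 * h) ^ 2) ^ j = c ^ 2 * h := fun h hh => by
    rw [mul_pow, mul_pow, hjH' h hh, ← pow_mul c, show 3 * 2 = 4 + 2 by rfl, pow_add, F.pow_four,
      one_mul, hz]
  convert (hX.pow_prime Nat.prime_two).pow_coprime hj using 1
  have key : ∀ g, g ∈ (fun x : G => x ^ j) '' {g | ¬ 2 ∣ {x | x ∈ X ∧ x ^ 2 = g}.ncard} ↔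
      ¬ 2 ∣ {x | x ∈ X ∧ (x ^ 2) ^ j = g}.ncard := by
    intro g
    obtain ⟨s, rfl⟩ := hbij.2 g
    rw [Function.Injective.mem_set_image hbij.1]
    simp only [Set.mem_ofPred_eq, hbij.1.eq_iff]
  ext g
  rw [key]
  obtain ⟨h, hh, hg⟩ := F.decomp g
  have ne : ∀ k ∈ H, (h ≠ c * k ∧ h ≠ c ^ 2 * k ∧ h ≠ c ^ 3 * k) := by
    intro k hk
    obtain ⟨h1, h2, h3⟩ := F.mul_notMem hk
    exact ⟨fun h => h1 (h ▸ hh), fun h => h2 (h ▸ hh), fun h => h3 (h ▸ hh)⟩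
  have ne' : ∀ k ∈ H, (k ≠ c * h ∧ k ≠ c ^ 2 * h ∧ k ≠ c ^ 3 * h) := by
    intro k hk
    obtain ⟨h1, h2, h3⟩ := F.mul_notMem hh
    exact ⟨fun h => h1 (h ▸ hk), fun h => h2 (h ▸ hk), fun h => h3 (h ▸ hk)⟩
  have hc1 : c ≠ 1 := fun h => F.notMem (h ▸ H.one_mem)
  have hc2 : c ^ 2 ≠ 1 := fun h => F.sq_notMem (h ▸ H.one_mem)
  rcases hg with rfl | rfl | rfl | rfl
  · rw [F.mem_oddFibre hh, ← not_two_dvd_ncard_pair (ne g hh).2.1]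
    suffices hs : ∀ x, (x = g ∨ x = c ^ 2 * g) ↔ (x ^ 2) ^ j = g by simp only [hs]
    intro x
    obtain ⟨k, hk, rfl | rfl | rfl | rfl⟩ := F.decomp x
    · rw [t0 _ hk]
      have := (ne' x hk).2.1
      tauto
    · rw [t1 k hk]
      have h1 := (ne k hk)
      have h2 : c * k ≠ c ^ 2 * g := by
        rw [← r1, Ne, mul_left_cancel_iff]; exact (ne' k hk).1
      exact ⟨fun h => h.elim (fun h => absurd h.symm h1.1) (fun h => absurd h h2),
        fun h => absurd h.symm h1.2.1⟩
    · rw [t2 k hk, mul_left_cancel_iff]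
      have h1 := (ne k hk)
      exact ⟨fun h => h.elim (fun h => absurd h.symm h1.2.1) id, Or.inr⟩
    · rw [t3 k hk]
      have h1 := (ne k hk)
      have h2 : c ^ 3 * k ≠ c ^ 2 * g := by
        rw [← r4, Ne, mul_left_cancel_iff]; exact fun h => (ne k hk).1 h.symm
      exact ⟨fun h => h.elim (fun h => absurd h.symm h1.2.2) (fun h => absurd h h2),
        fun h => absurd h.symm h1.2.1⟩
  · refine iff_of_false (F.mul_notMem_oddFibre hh).1 (not_not.2 ?_)
    rw [(Set.ncard_eq_zero (Set.toFinite _)).2 (Set.eq_empty_iff_forall_notMem.2 ?_)]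
    · exact dvd_zero 2
    rintro x ⟨-, hx⟩
    obtain ⟨k, hk, rfl | rfl | rfl | rfl⟩ := F.decomp x
    · exact (ne' x hk).1 ((t0 x hk).symm.trans hx)
    · rw [t1 k hk, ← r1, mul_left_cancel_iff] at hx
      exact (ne k hk).1 hx.symm
    · rw [t2 k hk] at hx
      exact (ne' k hk).1 hx
    · rw [t3 k hk, ← r1, mul_left_cancel_iff] at hx
      exact (ne k hk).1 hx.symm
  · have h2 : c * h ≠ c ^ 3 * h := by
      rw [← r2, Ne, mul_left_cancel_iff]; exact (ne h hh).2.1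
    rw [F.sq_mul_mem_oddFibre hh, ← not_two_dvd_ncard_pair h2]
    suffices hs : ∀ x, (x = c * h ∨ x = c ^ 3 * h) ↔ (x ^ 2) ^ j = c ^ 2 * h by simp only [hs]
    intro x
    obtain ⟨k, hk, rfl | rfl | rfl | rfl⟩ := F.decomp x
    · rw [t0 _ hk]
      exact iff_of_false (fun h => h.elim (ne' x hk).1 (ne' x hk).2.2) (ne' x hk).2.1
    · rw [t1 k hk, mul_left_cancel_iff, mul_left_cancel_iff, ← r2, mul_left_cancel_iff]
      have := (ne' k hk).2.1
      tauto
    · rw [t2 k hk]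
      refine iff_of_false (fun h => h.elim (fun h => ?_) (fun h => ?_)) (ne' k hk).2.1
      · rw [← r1, mul_left_cancel_iff] at h
        exact (ne k hk).1 h.symm
      · rw [← r4, mul_left_cancel_iff] at h
        exact (ne' k hk).1 h
    · rw [t3 k hk, mul_left_cancel_iff, mul_left_cancel_iff, ← r2, mul_left_cancel_iff]
      have := (ne k hk).2.1
      exact ⟨fun h => h.elim (fun h => absurd h.symm this) id, Or.inr⟩
  · refine iff_of_false (F.mul_notMem_oddFibre hh).2 (not_not.2 ?_)
    rw [(Set.ncard_eq_zero (Set.toFinite _)).2 (Set.eq_empty_iff_forall_notMem.2 ?_)]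
    · exact dvd_zero 2
    rintro x ⟨-, hx⟩
    obtain ⟨k, hk, rfl | rfl | rfl | rfl⟩ := F.decomp x
    · exact (ne' x hk).2.2 ((t0 x hk).symm.trans hx)
    · rw [t1 k hk, ← r4, mul_left_cancel_iff] at hx
      exact (ne' k hk).1 hx
    · rw [t2 k hk] at hx
      exact (ne' k hk).2.2 hx
    · rw [t3 k hk, ← r4, mul_left_cancel_iff] at hx
      exact (ne' k hk).1 hx

end SRing.IsASet

namespace Frame

variable {G : Type*} [CommGroup G] {p : ℕ} {c : G} {H : Subgroup G}
  {X : Set G}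

lemma pow_prime_eq (F : Frame p c H) : c ^ p = c ∨ c ^ p = c ^ 3 := by
  rw [pow_eq_pow_mod p F.pow_four]
  have h1 : p % 4 = 1 ∨ p % 4 = 3 := Nat.odd_mod_four_iff.1 (Nat.odd_iff.1 F.odd)
  rcases h1 with h | h <;> simp [h]

lemma ne_pow_three (F : Frame p c H) : c ≠ c ^ 3 := by
  intro h
  apply F.sq_notMem
  have h1 : c * 1 = c * c ^ 2 := by rw [← pow_succ', mul_one]; exact h
  rw [← mul_left_cancel h1]
  exact H.one_mem

variable [Finite G] {A : SRing G}

lemma sq_mem_stabilizer_iff (F : Frame p c H) : c ^ 2 ∈ MulAction.stabilizer G X ↔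
    ∀ h ∈ H, (h ∈ X ↔ c ^ 2 * h ∈ X) ∧ (c * h ∈ X ↔ c ^ 3 * h ∈ X) := by
  obtain ⟨r1, r2, r3, r4, r5, r6, r7, r8, r9⟩ := F.mul_rules
  rw [mem_stabilizer_set_iff]
  constructor
  · intro hs h _
    exact ⟨⟨hs _, fun h1 => r5 h ▸ hs _ h1⟩,
      ⟨fun h1 => r4 h ▸ hs _ h1, fun h1 => r6 h ▸ hs _ h1⟩⟩
  · intro hs g hg
    obtain ⟨h, hh, rfl | rfl | rfl | rfl⟩ := F.decomp g
    · exact (hs _ hh).1.1 hg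
    · rw [r4]; exact (hs h hh).2.1 hg
    · rw [r5]; exact (hs h hh).1.2 hg
    · rw [r6]; exact (hs h hh).2.2 hg

lemma isASubgroup_zpowers (F : Frame p c H) {W : Set G} (hW : A.IsASet W)
    (hW1 : ∀ g ∈ W, g = c ∨ g = c ^ 3) (hne : W.Nonempty) :
    A.IsASubgroup (Subgroup.zpowers c) := by
  have r : c ^ 4 = 1 := F.pow_four
  have h3 : (c ^ 3)⁻¹ = c := by rw [← F.inv_eq, inv_inv]
  have hV : W ∪ W⁻¹ = {c, c ^ 3} := by
    ext g
    simp only [Set.mem_union, Set.mem_inv, Set.mem_insert_iff, Set.mem_singleton_iff]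
    constructor
    · rintro (h | h)
      · exact hW1 g h
      · rcases hW1 _ h with h | h
        · right; rw [← F.inv_eq, ← h, inv_inv]
        · left; rw [← h3, ← h, inv_inv]
    · obtain ⟨w, hw⟩ := hne
      have : c ∈ W ∨ c ^ 3 ∈ W := by
        rcases hW1 w hw with rfl | rfl
        · exact Or.inl hw
        · exact Or.inr hw
      rintro (rfl | rfl)
      · rw [F.inv_eq]; exact this
      · rw [h3]; exact this.symm
  have h1 : A.IsASet ((W ∪ W⁻¹) ∪ (W ∪ W⁻¹) * (W ∪ W⁻¹)) :=
    (hW.union hW.inv).union ((hW.union hW.inv).mul (hW.union hW.inv))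
  change A.IsASet _
  convert h1 using 1
  rw [hV]
  ext g
  simp only [SetLike.mem_coe, Set.mem_union, Set.mem_mul, Set.mem_insert_iff,
    Set.mem_singleton_iff, exists_eq_or_imp, exists_eq_left]
  rw [← mem_powers_iff_mem_zpowers]
  constructor
  · rintro ⟨k, rfl⟩
    simp only
    rw [pow_eq_pow_mod k r]
    have : k % 4 < 4 := Nat.mod_lt _ (by norm_num)
    interval_cases k % 4
    · right; left; right
      rw [← pow_succ', r, pow_zero]
    · left; left; simp
    · right; left; left
      rw [pow_two]
    · left; right; simp
  · have hc : c ∈ Submonoid.powers c := Submonoid.mem_powers c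
    have hc3 := Submonoid.pow_mem _ hc 3
    rintro ((rfl | rfl) | ((rfl | rfl) | (rfl | rfl)))
    · exact hc
    · exact hc3
    · exact mul_mem hc hc
    · exact mul_mem hc hc3
    · exact mul_mem hc3 hc
    · exact mul_mem hc3 hc3

lemma prime_dvd_ncard (F : Frame p c H) (hC : ¬ A.IsASubgroup (Subgroup.zpowers c))
    (hX : A.IsASet X) (hXH : ∀ h ∈ H, h ∉ X ∧ c ^ 2 * h ∉ X) :
    p ∣ {x | x ∈ X ∧ c ^ 3 * x ∈ H}.ncard := by
  obtain ⟨r1, r2, r3, r4, r5, r6, r7, r8, r9⟩ := F.mul_rules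
  by_contra hnd
  refine hC (F.isASubgroup_zpowers (hX.pow_prime F.prime) ?_ ⟨c ^ p, ?_⟩)
  · intro g hg
    obtain ⟨x, hx, rfl⟩ : ∃ x ∈ X, x ^ p = g := by
      by_contra! hne
      apply hg
      rw [(Set.ncard_eq_zero (Set.toFinite _)).2 (Set.eq_empty_iff_forall_notMem.2 ?_)]
      · exact dvd_zero p
      · rintro x ⟨hx, hxg⟩
        exact hne x hx hxg
    obtain ⟨h, hh, rfl | rfl | rfl | rfl⟩ := F.decomp x
    · exact absurd hx (hXH _ hh).1
    · rw [mul_pow, F.pow_eq_one h hh, mul_one]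
      exact F.pow_prime_eq
    · exact absurd hx (hXH _ hh).2
    · rw [mul_pow, F.pow_eq_one h hh, mul_one, ← pow_mul, mul_comm, pow_mul]
      rcases F.pow_prime_eq with h | h
      · right; rw [h]
      · left; rw [h, ← F.inv_eq, F.inv_cube]
  · change ¬ _
    have hset : {x | x ∈ X ∧ x ^ p = c ^ p} = {x | x ∈ X ∧ c ^ 3 * x ∈ H} := by
      ext x
      refine and_congr_right fun hx => ?_
      obtain ⟨h, hh, rfl | rfl | rfl | rfl⟩ := F.decomp x
      · exact absurd hx (hXH _ hh).1
      · rw [mul_pow, F.pow_eq_one h hh, mul_one, r7]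
        simp [hh]
      · exact absurd hx (hXH _ hh).2
      · rw [mul_pow, F.pow_eq_one h hh, mul_one, r9]
        refine iff_of_false ?_ (F.mul_notMem hh).2.1
        rw [← pow_mul, mul_comm, pow_mul]
        have := F.ne_pow_three
        rcases F.pow_prime_eq with h | h
        · rw [h]; exact this.symm
        · rw [h, ← F.inv_eq, F.inv_cube, F.inv_eq]; exact this
    rwa [hset]

/-- The possible shapes of a basic set. -/
lemma basic_cases (F : Frame p c H) (hX : X ∈ A.basic) :
    X ⊆ A.core H ∨ c ^ 2 ∈ MulAction.stabilizer G X ∨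
    (∃ D, A.IsASet D ∧ D ⊆ A.core H ∧ D.Nonempty ∧ (∀ d ∈ D, d ∉ X ∧ c ^ 2 * d ∈ X) ∧
      c ^ 2 ∈ MulAction.stabilizer G (X ∪ D)) ∨
    ((∀ h ∈ H, h ∉ X ∧ c ^ 2 * h ∉ X) ∧
      ∃ D, A.IsASet D ∧ D ⊆ A.core H ∧ (∀ h ∈ H, h ∈ D ↔ ¬ (c * h ∈ X ↔ c ^ 3 * h ∈ X)) ∧
      ∀ h ∈ H, h ∉ D → c * h ∉ X ∧ c ^ 3 * h ∉ X) := by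
  obtain ⟨r1, r2, r3, r4, r5, r6, r7, r8, r9⟩ := F.mul_rules
  have hXA := SRing.IsASet.of_basic hX
  have hT := hXA.oddFibre F
  obtain ⟨s, hs1, hs2, hs⟩ := F.exists_pow 3 1
  specialize hs (by decide) (fun h => F.prime.one_lt.ne' (Nat.dvd_one.1 h))
  have e0 : ∀ h ∈ H, h ^ s = h := fun h hh => by rw [hs2 h hh, pow_one]
  have e1 : ∀ h ∈ H, (c * h) ^ s = c ^ 3 * h := fun h hh => by rw [mul_pow, hs1, e0 h hh]
  have e2 : ∀ h ∈ H, (c ^ 2 * h) ^ s = c ^ 2 * h := fun h hh => by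
    rw [mul_pow, e0 h hh, ← pow_mul, mul_comm 2, pow_mul, hs1, ← F.inv_eq, F.inv_sq]
  have e3 : ∀ h ∈ H, (c ^ 3 * h) ^ s = c * h := fun h hh => by
    rw [mul_pow, e0 h hh, ← pow_mul, mul_comm 3, pow_mul, hs1, ← F.inv_eq, F.inv_cube]
  by_cases hσ : ∃ x ∈ X, x ^ s ∈ X
  · obtain ⟨x, hx, hxs⟩ := hσ
    have h1 : ∀ y ∈ X, y ^ s ∈ X := by
      intro y hy
      have h2 := A.pow_cell hs x
      rw [← A.eq_cell hX hxs, ← A.eq_cell hX hx] at h2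
      rw [← h2]
      exact ⟨y, hy, rfl⟩
    have h13 : ∀ h ∈ H, (c * h ∈ X ↔ c ^ 3 * h ∈ X) := fun h hh =>
      ⟨fun h2 => e1 h hh ▸ h1 _ h2, fun h2 => e3 h hh ▸ h1 _ h2⟩
    have hTH : oddFibre c H X ⊆ H := by
      intro g hg
      obtain ⟨h, hh, rfl | rfl | rfl | rfl⟩ := F.decomp g
      · exact hh
      · exact absurd hg (F.mul_notMem_oddFibre hh).1
      · exact absurd (h13 h hh) ((F.sq_mul_mem_oddFibre hh).1 hg)
      · exact absurd hg (F.mul_notMem_oddFibre hh).2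
    have hTc := hT.subset_core hTH
    by_cases hmeet : ∃ g ∈ X, g ∈ oddFibre c H X
    · obtain ⟨g, hgX, hgT⟩ := hmeet
      exact Or.inl ((hT.basic_subset hX hgX hgT).trans hTc)
    push Not at hmeet
    rcases Set.eq_empty_or_nonempty (oddFibre c H X) with he | he
    · right; left
      rw [F.sq_mem_stabilizer_iff]
      refine fun h hh => ⟨?_, h13 h hh⟩
      by_contra h2
      rw [← F.mem_oddFibre hh, he] at h2
      exact h2
    · right; right; left
      refine ⟨_, hT, hTc, he, fun d hd => ?_, ?_⟩
      · have h2 := (F.mem_oddFibre (hTH hd)).1 hd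
        have h3 := fun h => hmeet d h hd
        tauto
      · rw [F.sq_mem_stabilizer_iff]
        intro h hh
        have h2 := F.mem_oddFibre (X := X) hh
        have h3 : h ∈ X → h ∉ oddFibre c H X := hmeet h
        have h4 : c ^ 2 * h ∉ oddFibre c H X := fun h5 => (F.mul_notMem hh).2.1 (hTH h5)
        have h5 : c * h ∉ oddFibre c H X := fun h5 => (F.mul_notMem hh).1 (hTH h5)
        have h6 : c ^ 3 * h ∉ oddFibre c H X := fun h5 => (F.mul_notMem hh).2.2 (hTH h5)
        have h7 := h13 h hh
        simp only [Set.mem_union]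
        tauto
  · push Not at hσ
    have h1 : ∀ h ∈ H, h ∉ X ∧ c ^ 2 * h ∉ X := fun h hh =>
      ⟨fun h2 => hσ _ h2 (by rwa [e0 h hh]), fun h2 => hσ _ h2 (by rwa [e2 h hh])⟩
    have h2 : ∀ h ∈ H, h ∉ oddFibre c H X := fun h hh => by
      rw [F.mem_oddFibre hh]
      have := h1 h hh
      tauto
    have hD := hT.oddFibre F
    have hDH : oddFibre c H (oddFibre c H X) ⊆ H := by
      intro g hg
      obtain ⟨h, hh, rfl | rfl | rfl | rfl⟩ := F.decomp g
      · exact hh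
      · exact absurd hg (F.mul_notMem_oddFibre hh).1
      · refine absurd ?_ ((F.sq_mul_mem_oddFibre hh).1 hg)
        exact iff_of_false (F.mul_notMem_oddFibre hh).1 (F.mul_notMem_oddFibre hh).2
      · exact absurd hg (F.mul_notMem_oddFibre hh).2
    have hiff : ∀ h ∈ H, h ∈ oddFibre c H (oddFibre c H X) ↔ ¬ (c * h ∈ X ↔ c ^ 3 * h ∈ X) :=
      fun h hh => by
        rw [F.mem_oddFibre hh, F.sq_mul_mem_oddFibre hh]
        have := h2 h hh
        tauto
    refine Or.inr (Or.inr (Or.inr ⟨h1, _, hD, hD.subset_core hDH, hiff, fun h hh hn => ?_⟩))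
    rw [hiff h hh] at hn
    have h3 : c * h ∈ X → c ^ 3 * h ∉ X := fun h4 h5 => hσ _ h4 (by rwa [e1 h hh])
    tauto

end Frame

namespace Frame

variable {G : Type*} [CommGroup G] [Finite G] {A : SRing G} {p : ℕ} {c : G} {H : Subgroup G}
  {X : Set G}

lemma smul_core_eq (F : Frame p c H) (hC : ¬ A.IsASubgroup (Subgroup.zpowers c))
    (hle : Nat.card (A.core H) ≤ p) (hX : A.IsASet X) (hXH : ∀ h ∈ H, h ∉ X ∧ c ^ 2 * h ∉ X)
    (hXc : ∀ h ∈ H, c * h ∈ X → h ∈ A.core H) {h : G} (hh : h ∈ H) (hhX : c * h ∈ X) :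
    Nat.card (A.core H) = p ∧ ∀ d ∈ A.core H, c * d ∈ X := by
  obtain ⟨r1, r2, r3, r4, r5, r6, r7, r8, r9⟩ := F.mul_rules
  have h1 := F.prime_dvd_ncard hC hX hXH
  have hsub : {x | x ∈ X ∧ c ^ 3 * x ∈ H} ⊆ c • (A.core H : Set G) := by
    rintro x ⟨hx, hxH⟩
    refine ⟨c ^ 3 * x, hXc _ hxH ?_, r3 x⟩
    rwa [r3]
  have hcard : (c • (A.core H : Set G)).ncard = Nat.card (A.core H) := by
    rw [Set.ncard_smul_set]
    rfl
  have hpos : 0 < {x | x ∈ X ∧ c ^ 3 * x ∈ H}.ncard :=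
    (Set.ncard_pos (Set.toFinite _)).2 ⟨c * h, hhX, by rwa [r7]⟩
  have h2 := Nat.le_of_dvd hpos h1
  have h3 := Set.ncard_le_ncard hsub (Set.toFinite _)
  refine ⟨by omega, fun d hd => ?_⟩
  have h4 := Set.eq_of_subset_of_ncard_le hsub (by omega) (Set.toFinite _)
  have h5 : c * d ∈ c • (A.core H : Set G) := ⟨d, hd, rfl⟩
  rw [← h4] at h5
  exact h5.1

lemma odd_basic (F : Frame p c H) (hC : ¬ A.IsASubgroup (Subgroup.zpowers c))
    (hle : Nat.card (A.core H) ≤ p) (hX : X ∈ A.basic) (hXH : ∀ h ∈ H, h ∉ X ∧ c ^ 2 * h ∉ X)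
    {D : Set G} (hD : D ⊆ A.core H) (hD1 : ∀ h ∈ H, h ∈ D ↔ ¬ (c * h ∈ X ↔ c ^ 3 * h ∈ X))
    (hD2 : ∀ h ∈ H, h ∉ D → c * h ∉ X ∧ c ^ 3 * h ∉ X) :
    Nat.card (A.core H) = p ∧
      (X = c • (A.core H : Set G) ∨ X = c ^ 3 • (A.core H : Set G)) := by
  have hXA := SRing.IsASet.of_basic hX
  have key : ∀ {a : G}, Frame p a H → (∀ h ∈ H, h ∉ X ∧ a ^ 2 * h ∉ X) →
      (¬ A.IsASubgroup (Subgroup.zpowers a)) → (∀ h ∈ H, a * h ∈ X → h ∈ D) →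
      (∀ h ∈ H, a ^ 3 * h ∈ X → h ∈ D) →
      (∀ h ∈ H, a * h ∈ X → a ^ 3 * h ∉ X) → ∀ h ∈ H, a * h ∈ X →
      Nat.card (A.core H) = p ∧ X = a • (A.core H : Set G) := by
    intro a F' k1 k2 k3 k3' k4 h hh hhX
    have h1 : ∀ h ∈ H, a * h ∈ X → h ∈ A.core H := fun h hh h2 => hD (k3 h hh h2)
    obtain ⟨h2, h3⟩ := F'.smul_core_eq k2 hle hXA k1 h1 hh hhX
    refine ⟨h2, Set.Subset.antisymm (fun g hg => ?_) ?_⟩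
    · obtain ⟨d, hd, rfl | rfl | rfl | rfl⟩ := F'.decomp g
      · exact absurd hg (k1 _ hd).1
      · exact ⟨d, h1 d hd hg, rfl⟩
      · exact absurd hg (k1 _ hd).2
      · exact absurd hg (k4 d hd (h3 d (hD (k3' d hd hg))))
    · rintro _ ⟨d, hd, rfl⟩
      exact h3 d hd
  have n1 : ∀ h ∈ H, c * h ∈ X → h ∈ D := fun h hh h1 => by_contra fun h2 => (hD2 h hh h2).1 h1
  have n3 : ∀ h ∈ H, c ^ 3 * h ∈ X → h ∈ D := fun h hh h1 =>
    by_contra fun h2 => (hD2 h hh h2).2 h1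
  have n4 : ∀ h ∈ H, c * h ∈ X → c ^ 3 * h ∉ X := fun h hh h1 h2 =>
    (hD1 h hh).1 (n1 h hh h1) (iff_of_true h1 h2)
  obtain ⟨g, hg⟩ := A.nonempty X hX
  obtain ⟨h, hh, rfl | rfl | rfl | rfl⟩ := F.decomp g
  · exact absurd hg (hXH _ hh).1
  · obtain ⟨h1, h2⟩ := key F hXH hC n1 n3 n4 h hh hg
    exact ⟨h1, Or.inl h2⟩
  · exact absurd hg (hXH _ hh).2
  · obtain ⟨h1, h2⟩ := key F.inv (by rwa [F.inv_sq]) (by rwa [Subgroup.zpowers_inv])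
      (by rwa [F.inv_eq]) (by rwa [F.inv_cube])
      (by rw [F.inv_cube, F.inv_eq]; exact fun h hh h1 h2 => n4 h hh h2 h1) h hh
      (by rwa [F.inv_eq])
    exact ⟨h1, Or.inr (by rw [h2, F.inv_eq])⟩

lemma basic_cases_of_ne (F : Frame p c H) (hC : ¬ A.IsASubgroup (Subgroup.zpowers c))
    (hne : A.core H ≠ H) (hX : X ∈ A.basic) :
    X ⊆ A.core H ∨ c ^ 2 ∈ MulAction.stabilizer G X ∨ (∃ d ∈ A.core H, X = A.cell (c ^ 2 * d)) ∨
    (Nat.card (A.core H) = p ∧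
      (X = c • (A.core H : Set G) ∨ X = c ^ 3 • (A.core H : Set G))) := by
  have hle : Nat.card (A.core H) ≤ p := by
    by_cases h : A.core H = ⊥
    · rw [h, Subgroup.card_bot]
      exact F.prime.one_le
    · exact (F.card_eq (SRing.core_le H) h hne).le
  rcases F.basic_cases hX with h | h | ⟨D, hD, hDc, ⟨d, hd⟩, hDX, -⟩ | ⟨h1, D, hD, hDc, h2, h3⟩
  · exact Or.inl h
  · exact Or.inr (Or.inl h)
  · exact Or.inr (Or.inr (Or.inl ⟨d, hDc hd, A.eq_cell hX (hDX d hd).2⟩))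
  · exact Or.inr (Or.inr (Or.inr (F.odd_basic hC hle hX h1 hDc h2 h3)))

/-- The smallest `A`-subgroup containing the involution `c ^ 2`. -/
structure SqHull (A : SRing G) (c : G) (H N : Subgroup G) : Prop where
  isASubgroup : A.IsASubgroup N
  sq_mem : c ^ 2 ∈ N
  mem : ∀ n ∈ N, n ∈ A.cell (c ^ 2) ∨ n ∈ A.core H
  le : ∀ V : Subgroup G, A.IsASubgroup V → c ^ 2 ∈ V → N ≤ V

lemma SqHull.le_stabilizer {N : Subgroup G} (hN : SqHull A c H N) (hX : A.IsASet X)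
    (h : c ^ 2 ∈ MulAction.stabilizer G X) : N ≤ MulAction.stabilizer G X :=
  hN.le _ hX.stabilizer h

lemma exists_sqHull (F : Frame p c H) : ∃ N, SqHull A c H N := by
  have hz : c ^ 2 ∈ A.cell (c ^ 2) := A.mem_cell _
  have hz2 : c ^ 2 * c ^ 2 = 1 := by rw [← pow_add]; exact F.pow_four
  rcases F.basic_cases (A.cell_mem_basic (c ^ 2)) with h | h | ⟨D, hD, hDc, -, hDX, hDz⟩ | ⟨h, -⟩
  · exact absurd (SRing.core_le H (h hz)) F.sq_notMem
  · have h1 := mem_stabilizer_set_iff.1 h _ hz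
    rw [hz2] at h1
    replace h1 := A.mem_cell_comm h1
    rw [A.cell_one, Set.mem_singleton_iff] at h1
    exact absurd (h1 ▸ H.one_mem) F.sq_notMem
  · refine ⟨MulAction.stabilizer G (A.cell (c ^ 2) ∪ D),
      ((SRing.IsASet.cell _).union hD).stabilizer, hDz, fun n hn => ?_, fun V hV hVz n hn => ?_⟩
    all_goals
      have h1 := mem_stabilizer_set_iff.1 hDz _ (Or.inl hz)
      rw [hz2] at h1
      have h2 := mem_stabilizer_set_iff.1 hn _ h1
      rw [mul_one] at h2
    · exact h2.imp_right fun h3 => hDc h3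
    · rcases h2 with h2 | h2
      · exact hV.cell_subset hVz h2
      · exact (V.mul_mem_cancel_left hVz).1 (hV.cell_subset hVz (hDX n h2).2)
  · exact absurd (by rwa [mul_one]) (h 1 H.one_mem).2

lemma conclusion_of_core_eq_bot (F : Frame p c H) (hC : ¬ A.IsASubgroup (Subgroup.zpowers c))
    (hcore : A.core H = ⊥) (hne : A.core H ≠ H) :
    A.basic.ncard = 2 ∨ WreathConclusion p A := by
  obtain ⟨N, hN⟩ := F.exists_sqHull (A := A)
  have hz1 : c ^ 2 ≠ 1 := fun h => F.sq_notMem (h ▸ H.one_mem)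
  by_cases hNt : N = ⊤
  · left
    have h1 : ∀ g : G, g ≠ 1 → g ∈ A.cell (c ^ 2) := fun g hg =>
      (hN.mem g (hNt ▸ Subgroup.mem_top g)).resolve_right fun h => hg (by simpa [hcore] using h)
    exact SRing.ncard_basic_eq_two
      (fun g x hg hx => A.cell_eq_of_mem (h1 g hg) ▸ h1 x hx) hz1
  · right
    refine ⟨N, N, le_rfl, hN.isASubgroup, hN.isASubgroup,
      fun h => hz1 (by simpa [h] using hN.sq_mem), hNt, fun X hX hXN => ?_, Or.inl condCA_self⟩
    rcases F.basic_cases_of_ne hC hne hX with h | h | ⟨d, hd, rfl⟩ | ⟨h, -⟩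
    · exact absurd (h.trans (by simp [hcore])) hXN
    · exact subset_rad (hN.le_stabilizer (.of_basic hX) h)
    · refine absurd (hN.isASubgroup.cell_subset ?_) hXN
      rw [hcore, Subgroup.mem_bot] at hd
      simpa [hd] using hN.sq_mem
    · rw [hcore, Subgroup.card_bot] at h
      exact absurd h F.prime.one_lt.ne

lemma conclusion_of_core_le (F : Frame p c H) (hC : ¬ A.IsASubgroup (Subgroup.zpowers c))
    (hcore : A.core H ≠ ⊥) (hne : A.core H ≠ H) {N : Subgroup G} (hN : SqHull A c H N)
    (hle : A.core H ≤ N) : WreathConclusion p A := by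
  refine ⟨A.core H, A.core H, le_rfl, SRing.isASubgroup_core H, SRing.isASubgroup_core H, hcore,
    fun h => F.notMem (SRing.core_le H (h ▸ Subgroup.mem_top c)), fun X hX hXN => ?_,
    Or.inl condCA_self⟩
  rcases F.basic_cases_of_ne hC hne hX with h | h | ⟨d, hd, rfl⟩ | ⟨-, h⟩
  · exact absurd h hXN
  · exact subset_rad (hle.trans (hN.le_stabilizer (.of_basic hX) h))
  · have h1 : c ^ 2 * d ∉ A.core H := fun h => (F.mul_notMem (SRing.core_le H hd)).2.1
      (SRing.core_le H h)
    have h2 := (hN.mem _ (N.mul_mem hN.sq_mem (hle hd))).resolve_right h1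
    refine subset_rad fun k hk => mem_stabilizer_set_iff.2 fun x hx => ?_
    have hx1 : x ∉ A.core H := fun h3 => h1
      ((SRing.isASubgroup_core H).cell_subset h3 (A.mem_cell_comm hx))
    have hxN : x ∈ N := hN.isASubgroup.cell_subset (N.mul_mem hN.sq_mem (hle hd)) hx
    rw [A.cell_eq_of_mem h2]
    exact (hN.mem _ (N.mul_mem (hle hk) hxN)).resolve_right
      fun h3 => hx1 (((A.core H).mul_mem_cancel_left hk).1 h3)
  · have h1 : ∀ a : G, ((A.core H : Set G) ⊆ rad (a • (A.core H : Set G))) := by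
      refine fun a => subset_rad fun k hk => mem_stabilizer_set_iff.2 ?_
      rintro _ ⟨d, hd, rfl⟩
      exact ⟨k * d, (A.core H).mul_mem hk hd, mul_left_comm _ _ _⟩
    rcases h with rfl | rfl
    exacts [h1 _, h1 _]

end Frame

lemma SRing.IsASet.singleton_pow {G : Type*} [Group G] [Finite G] {A : SRing G} {g : G}
    (h : A.IsASet {g}) (n : ℕ) : A.IsASet {g ^ n} := by
  induction n with
  | zero => rw [pow_zero]; exact SRing.isASet_one
  | succ n ih => rw [pow_succ, ← Set.singleton_mul_singleton]; exact ih.mul h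

namespace Frame

variable {G : Type*} [CommGroup G] [Finite G] {A : SRing G} {p : ℕ} {c : G} {H : Subgroup G}
  {X : Set G}

lemma isCyclotomic_quot (F : Frame p c H) {L W : Subgroup G} {e : G} (hL : A.IsASubgroup L)
    (hW : A.IsASubgroup W) (hc : ∀ x ∈ A.cell c, c⁻¹ * x ∈ L) (heW : e ∈ W) (heL : e ∉ L)
    (hep : e ^ p = 1) (hWe : ∀ w ∈ W, ∃ k : ℕ, ∃ l ∈ L, w = e ^ k * l) (hHW : H ≤ W ⊔ L)
    {AQ : SRing (G ⧸ L)} (hAQ : AQ.basic = quotBasic A L) : AQ.IsCyclotomic := by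
  have hd : AQ.IsASet {(c : G ⧸ L)} := by
    convert (SRing.IsASet.cell c).quot hL hAQ
    ext q
    constructor
    · rintro rfl
      exact ⟨c, A.mem_cell c, rfl⟩
    · rintro ⟨x, hx, rfl⟩
      exact (QuotientGroup.eq.2 (hc x hx)).symm
  have hml : ∀ g, ∀ l ∈ L, ((g * l : G) : G ⧸ L) = g := fun g l hl =>
    (QuotientGroup.eq.2 (by simpa using hl)).symm
  refine SRing.isCyclotomic_of_prime_compl (q := p) (D := Subgroup.zpowers (c : G ⧸ L))
    (E := W.map (QuotientGroup.mk' L)) F.prime ?_ ?_ ?_ ?_ ?_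
  · rw [eq_top_iff]
    rintro q -
    obtain ⟨g, rfl⟩ := QuotientGroup.mk_surjective q
    obtain ⟨i, h, hh, rfl⟩ := F.exists_pow_mul g
    obtain ⟨w, hw, l, hl, rfl⟩ := Subgroup.mem_sup.1 (hHW hh)
    rw [← mul_assoc, hml _ _ hl]
    exact Subgroup.mul_mem_sup (Subgroup.npow_mem_zpowers _ i)
      (Subgroup.mem_map_of_mem (QuotientGroup.mk' L) hw)
  · refine card_eq_of_pow F.prime (e := (e : G ⧸ L)) ⟨e, heW, rfl⟩
      (fun h => heL ((QuotientGroup.eq_one_iff e).1 h)) ?_ ?_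
    · rw [← QuotientGroup.mk_pow, hep]; rfl
    · rintro _ ⟨w, hw, rfl⟩
      obtain ⟨k, l, hl, rfl⟩ := hWe w hw
      exact ⟨k, hml _ _ hl⟩
  · rw [Nat.card_zpowers]
    refine F.coprime_four.coprime_dvd_left (orderOf_dvd_of_pow_eq_one ?_)
    rw [← QuotientGroup.mk_pow, F.pow_four]; rfl
  · intro d hdm
    obtain ⟨n, rfl⟩ := mem_powers_iff_mem_zpowers.2 hdm
    exact hd.singleton_pow n
  · have := hW.quot hL hAQ
    exact this

lemma cell_mul (F : Frame p c H) {N : Subgroup G} (hN : SqHull A c H N)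
    (hinf : ∀ n ∈ N, n ∈ A.core H → n = 1) {n h : G} (hn : n ∈ N) (hh : h ∈ A.core H) :
    A.cell (n * h) = A.cell n * A.cell h := by
  have hH := SRing.core_le H hh
  have hcR : A.cell h ⊆ A.core H := (SRing.isASubgroup_core H).cell_subset hh
  have hzN : A.cell (c ^ 2) ⊆ N := hN.isASubgroup.cell_subset hN.sq_mem
  have hz1 : c ^ 2 ≠ 1 := fun h => F.sq_notMem (h ▸ H.one_mem)
  have hcz : ∀ x ∈ A.cell (c ^ 2), x ∉ A.core H := by
    intro x hx hxR
    have h1 := A.mem_cell_comm hx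
    rw [hinf x (hzN hx) hxR, A.cell_one] at h1
    exact hz1 h1
  have key : ∀ x ∈ A.cell (c ^ 2), ∀ y ∈ A.cell h, x * y ∈ A.cell (c ^ 2 * h) := by
    intro x hx y hy
    have hnY : h ∉ A.cell (c ^ 2 * h) := fun h1 =>
      (F.mul_notMem hH).2.1 (SRing.core_le H (hcR (A.mem_cell_comm h1)))
    rcases F.basic_cases (A.cell_mem_basic (c ^ 2 * h)) with
      h1 | h1 | ⟨D, hD, hDc, -, hDX, hDz⟩ | ⟨h1, -⟩
    · exact absurd (SRing.core_le H (h1 (A.mem_cell _))) (F.mul_notMem hH).2.1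
    · refine absurd ?_ hnY
      have h2 := mem_stabilizer_set_iff.1 h1 _ (A.mem_cell _)
      rwa [F.mul_rules.2.2.2.2.1] at h2
    · have h2 := mem_stabilizer_set_iff.1 hDz _ (Or.inl (A.mem_cell _))
      rw [F.mul_rules.2.2.2.2.1] at h2
      have h3 : y ∈ D := hD.cell_subset (h2.resolve_left hnY) hy
      have h4 := hN.le_stabilizer ((SRing.IsASet.cell _).union hD) hDz (hzN hx)
      refine (mem_stabilizer_set_iff.1 h4 y (Or.inr h3)).resolve_right fun h5 => ?_
      exact hcz x hx (((A.core H).mul_mem_cancel_right (hDc h3)).1 (hDc h5))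
    · exact absurd (A.mem_cell _) (h1 h hH).2
  have main : ∀ n ∈ A.cell (c ^ 2), A.cell (n * h) = A.cell n * A.cell h := by
    intro n hn
    refine Set.Subset.antisymm (((SRing.IsASet.cell n).mul (SRing.IsASet.cell h)).cell_subset
      (Set.mul_mem_mul (A.mem_cell n) (A.mem_cell h))) ?_
    rintro _ ⟨x, hx, y, hy, rfl⟩
    rw [A.cell_eq_of_mem hn] at hx
    rw [A.cell_eq_of_mem (key n hn h (A.mem_cell h))]
    exact key x hx y hy
  rcases hN.mem n hn with h1 | h1
  · exact main n h1
  · rw [hinf n hn h1, one_mul, A.cell_one, Set.singleton_one, one_mul]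

lemma tensorConclusion (F : Frame p c H) {N : Subgroup G} (hN : SqHull A c H N)
    (hinf : ∀ n ∈ N, n ∈ A.core H → n = 1) (hcore : A.core H ≠ ⊥) (htop : N ⊔ A.core H = ⊤) :
    TensorConclusion A := by
  have hbot : N ⊓ A.core H = ⊥ := by
    rw [eq_bot_iff]
    exact fun n hn => hinf n hn.1 hn.2
  have hz1 : c ^ 2 ≠ 1 := fun h => F.sq_notMem (h ▸ H.one_mem)
  refine ⟨N, A.core H, fun h => hz1 (by simpa [h] using hN.sq_mem), ?_, hcore,
    fun h => F.notMem (SRing.core_le H (h ▸ Subgroup.mem_top c)), hN.isASubgroup,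
    SRing.isASubgroup_core H, hbot, htop, ?_⟩
  · rintro rfl
    exact hcore (by simpa using hbot)
  · ext X
    constructor
    · intro hX
      obtain ⟨x, hx⟩ := A.nonempty X hX
      obtain ⟨n, hn, h, hh, rfl⟩ := Subgroup.mem_sup.1 (htop ▸ Subgroup.mem_top x)
      exact ⟨_, A.cell_mem_basic n, _, A.cell_mem_basic h, hN.isASubgroup.cell_subset hn,
        (SRing.isASubgroup_core H).cell_subset hh,
        by rw [A.eq_cell hX hx, F.cell_mul hN hinf hn hh]⟩
    · rintro ⟨Y, hY, Z, hZ, hYN, hZR, rfl⟩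
      obtain ⟨y, hy⟩ := A.nonempty Y hY
      obtain ⟨z, hz⟩ := A.nonempty Z hZ
      rw [A.eq_cell hY hy, A.eq_cell hZ hz, ← F.cell_mul hN hinf (hYN hy) (hZR hz)]
      exact A.cell_mem_basic _

end Frame

lemma tensorWreathBasic_eq {G : Type*} [CommGroup G] [Finite G] {A : SRing G}
    {U L R : Subgroup G} (hLU : L ≤ U) (hRU : R ≤ U) (hR : A.IsASubgroup R)
    (h1 : ∀ l ∈ L, ∀ r ∈ R, A.cell (l * r) = l • A.cell r)
    (h2 : ∀ u ∈ U, u ∉ L ⊔ R → A.cell u = u • (R : Set G))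
    {AU : SRing U} (hAU : AU.basic = restrictBasic A U) :
    AU.basic = tensorWreathBasic AU (L.subgroupOf U) (R.subgroupOf U) := by
  have hb : ∀ Z : Set U, Z ∈ AU.basic ↔ Subtype.val '' Z ∈ A.basic := fun Z => by rw [hAU]; rfl
  have hsm : ∀ (u : U) (Z : Set U), Subtype.val '' (u • Z) = (u : G) • (Subtype.val '' Z) := by
    intro u Z
    simp only [← Set.image_smul, Set.image_image]
    rfl
  have hpre : ∀ Y : Set G, Y ⊆ U → Subtype.val '' (Subtype.val ⁻¹' Y : Set U) = Y := fun Y hY =>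
    Set.image_preimage_eq_of_subset (by simpa using hY)
  have hRv : Subtype.val '' ((R.subgroupOf U : Subgroup U) : Set U) = R := hpre R hRU
  have hinj : Function.Injective (Set.image (Subtype.val : U → G)) :=
    Set.image_injective.2 Subtype.val_injective
  have hsup : ∀ u : U, u ∈ L.subgroupOf U ⊔ R.subgroupOf U ↔ (u : G) ∈ L ⊔ R := fun u => by
    rw [← Subgroup.subgroupOf_sup hLU hRU]
    exact Subgroup.mem_subgroupOf
  ext Z
  constructor
  · intro hZ
    obtain ⟨u, hu⟩ := AU.nonempty Z hZ
    have hZu := A.eq_cell ((hb Z).1 hZ) ⟨u, hu, rfl⟩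
    by_cases huS : u ∈ L.subgroupOf U ⊔ R.subgroupOf U
    · left
      obtain ⟨l, hl, r, hr, hlr⟩ := Subgroup.mem_sup.1 ((hsup u).1 huS)
      have hrc : A.cell r ⊆ R := hR.cell_subset hr
      refine ⟨⟨l, hLU hl⟩, hl, Subtype.val ⁻¹' A.cell r, ?_, fun x hx => hrc hx, ?_⟩
      · rw [hb, hpre _ (hrc.trans hRU)]
        exact A.cell_mem_basic r
      · apply hinj
        rw [hsm, hpre _ (hrc.trans hRU), hZu, ← hlr, h1 l hl r hr]
    · right
      refine ⟨u, huS, hinj ?_⟩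
      rw [hsm, hRv, hZu, h2 u u.2 (fun h => huS ((hsup u).2 h))]
  · rintro (⟨l, hl, X, hX, hXR, rfl⟩ | ⟨u, hu, rfl⟩)
    · obtain ⟨r, hr⟩ := AU.nonempty X hX
      rw [hb, hsm, A.eq_cell ((hb X).1 hX) ⟨r, hr, rfl⟩, ← h1 l hl r (hXR hr)]
      exact A.cell_mem_basic _
    · rw [hb, hsm, hRv, ← h2 u u.2 (fun h => hu ((hsup u).2 h))]
      exact A.cell_mem_basic _

namespace Frame

variable {G : Type*} [CommGroup G] {p : ℕ} {c : G} {H : Subgroup G}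

lemma orderOf_mul_eq (F : Frame p c H) {e : G} (he : e ∈ H) (he1 : e ≠ 1) :
    orderOf (c * e) = 4 * p := by
  have : Fact p.Prime := ⟨F.prime⟩
  have h1 : orderOf c = 2 ^ (1 + 1) := by
    refine orderOf_eq_prime_pow ?_ F.pow_four
    intro h
    exact F.sq_notMem (by rw [← pow_one 2, h]; exact H.one_mem)
  have h2 : orderOf e = p := orderOf_eq_prime (F.pow_eq_one e he) he1
  rw [(Commute.all c e).orderOf_mul_eq_mul_orderOf_of_coprime, h1, h2]
  · norm_num
  · rw [h1, h2]; exact F.coprime_four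

lemma exists_ne_one_of_card (F : Frame p c H) {R : Subgroup G} (hcard : Nat.card R = p) :
    ∃ e ∈ R, e ≠ 1 := by
  rw [← Subgroup.nontrivial_iff_exists_ne_one, Subgroup.nontrivial_iff_ne_bot]
  rintro rfl
  rw [Subgroup.card_bot] at hcard
  exact F.prime.one_lt.ne hcard

variable [Finite G] {A : SRing G}

lemma mem_sup_zpowers (F : Frame p c H) {R : Subgroup G} {u : G} :
    u ∈ R ⊔ Subgroup.zpowers c ↔ ∃ r ∈ R, u = r ∨ u = c * r ∨ u = c ^ 2 * r ∨ u = c ^ 3 * r := by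
  constructor
  · intro hu
    obtain ⟨r, hr, k, hk, rfl⟩ := Subgroup.mem_sup.1 hu
    obtain ⟨i, rfl⟩ := mem_powers_iff_mem_zpowers.2 hk
    refine ⟨r, hr, ?_⟩
    simp only [mul_comm r]
    rw [pow_eq_pow_mod i F.pow_four]
    have : i % 4 < 4 := Nat.mod_lt _ (by norm_num)
    interval_cases i % 4 <;> simp
  · have h1 : c ∈ R ⊔ Subgroup.zpowers c :=
      Subgroup.mem_sup_right (Subgroup.mem_zpowers c)
    rintro ⟨r, hr, h⟩
    replace hr : r ∈ R ⊔ Subgroup.zpowers c := Subgroup.mem_sup_left hr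
    rcases h with rfl | rfl | rfl | rfl
    · exact hr
    · exact mul_mem h1 hr
    · exact mul_mem (pow_mem h1 2) hr
    · exact mul_mem (pow_mem h1 3) hr

lemma zpowers_mul_eq (F : Frame p c H) {R : Subgroup G} (hR : R ≤ H) {e : G} (he : e ∈ R)
    (hRe : ∀ r ∈ R, ∃ k : ℕ, r = e ^ k) :
    Subgroup.zpowers (c * e) = R ⊔ Subgroup.zpowers c := by
  refine le_antisymm ?_ (sup_le (fun r hr => ?_) ?_)
  · rw [Subgroup.zpowers_le, F.mem_sup_zpowers]
    exact ⟨e, he, by simp⟩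
  · obtain ⟨k, rfl⟩ := hRe r hr
    obtain ⟨m, hm, hm', -⟩ := F.exists_pow 0 k
    have := Subgroup.npow_mem_zpowers (c * e) m
    rwa [mul_pow, hm, hm' e (hR he), pow_zero, one_mul] at this
  · rw [Subgroup.zpowers_le]
    obtain ⟨m, hm, hm', -⟩ := F.exists_pow 1 0
    have := Subgroup.npow_mem_zpowers (c * e) m
    rwa [mul_pow, hm, hm' e (hR he), pow_zero, pow_one, mul_one] at this

lemma SqHull.ne_bot (F : Frame p c H) {N : Subgroup G} (hN : SqHull A c H N) : N ≠ ⊥ := fun h =>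
  F.sq_notMem (by rw [show c ^ 2 = 1 by simpa [h] using hN.sq_mem]; exact H.one_mem)

lemma SqHull.card_eq_two (F : Frame p c H) {N : Subgroup G} (hN : SqHull A c H N)
    (h : ∀ n ∈ N, n = 1 ∨ n = c ^ 2) : Nat.card N = 2 := by
  have hz1 : c ^ 2 ≠ 1 := fun h => F.sq_notMem (h ▸ H.one_mem)
  have : (N : Set G) = {1, c ^ 2} := by
    ext n
    refine ⟨h n, ?_⟩
    rintro (rfl | rfl)
    exacts [N.one_mem, hN.sq_mem]
  change (N : Set G).ncard = 2
  rw [this, Set.ncard_pair hz1.symm]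

lemma SqHull.cell_eq (F : Frame p c H) {N : Subgroup G} (hN : SqHull A c H N)
    (h : ∀ n ∈ N, n = 1 ∨ n = c ^ 2) {n : G} (hn : n ∈ N) : A.cell n = {n} := by
  refine Set.Subset.antisymm (fun x hx => ?_) (by simpa using A.mem_cell n)
  rcases h n hn with rfl | rfl
  · rwa [A.cell_one] at hx
  · refine (h x (hN.isASubgroup.cell_subset hN.sq_mem hx)).resolve_left ?_
    rintro rfl
    have := A.mem_cell_comm hx
    rw [A.cell_one] at this
    exact F.sq_notMem (by rw [this]; exact H.one_mem)

lemma conclusion_of_odd_basic (F : Frame p c H) (hC : ¬ A.IsASubgroup (Subgroup.zpowers c))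
    (hne : A.core H ≠ H) {N : Subgroup G} (hN : SqHull A c H N)
    (hinf : ∀ n ∈ N, n ∈ A.core H → n = 1) (hcard : Nat.card (A.core H) = p)
    (hodd : c • (A.core H : Set G) ∈ A.basic) : WreathConclusion p A := by
  obtain ⟨r1, r2, r3, r4, r5, r6, r7, r8, r9⟩ := F.mul_rules
  have hR := SRing.core_le (A := A) H
  have hRA := SRing.isASubgroup_core (A := A) H
  have hodd3 : c ^ 3 • (A.core H : Set G) ∈ A.basic := by
    convert A.inv_mem _ hodd using 1
    rw [← F.inv_eq]
    ext g
    simp only [Set.mem_smul_set_iff_inv_smul_mem, Set.mem_inv, smul_eq_mul, SetLike.mem_coe]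
    rw [← inv_mem_iff, mul_inv, inv_inv]
  have hsq : A.IsASet (c ^ 2 • (A.core H : Set G)) := by
    convert (SRing.IsASet.of_basic hodd).mul (.of_basic hodd) using 1
    rw [smul_mul_smul_comm, ← pow_two, ← Subgroup.mul_normal, sup_idem]
  have hN2 : ∀ n ∈ N, n = 1 ∨ n = c ^ 2 := by
    intro n hn
    rcases hN.mem n hn with h | h
    · obtain ⟨r, hr, rfl⟩ := hsq.cell_subset (g := c ^ 2)
        ⟨1, (A.core H).one_mem, mul_one _⟩ h
      right
      have := hinf r ((N.mul_mem_cancel_left hN.sq_mem).1 hn) hr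
      simp [this]
    · exact Or.inl (hinf n hn h)
  obtain ⟨e, he, he1⟩ := F.exists_ne_one_of_card hcard
  have hRe : ∀ r ∈ A.core H, ∃ k : ℕ, r = e ^ k := fun r hr =>
    exists_pow_of_card_eq_prime F.prime hcard he he1 hr
  set U := A.core H ⊔ Subgroup.zpowers c with hU
  have hUe : U = Subgroup.zpowers (c * e) := (F.zpowers_mul_eq hR he hRe).symm
  have hRU : A.core H ≤ U := le_sup_left
  have hcU : c ∈ U := Subgroup.mem_sup_right (Subgroup.mem_zpowers c)
  have hNU : N ≤ U := fun n hn => by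
    rcases hN2 n hn with rfl | rfl
    exacts [U.one_mem, U.pow_mem hcU 2]
  have hcell1 : ∀ r ∈ A.core H, A.cell (c * r) = c • (A.core H : Set G) := fun r hr =>
    (A.eq_cell hodd ⟨r, hr, rfl⟩).symm
  have hcell3 : ∀ r ∈ A.core H, A.cell (c ^ 3 * r) = c ^ 3 • (A.core H : Set G) := fun r hr =>
    (A.eq_cell hodd3 ⟨r, hr, rfl⟩).symm
  have hcell2 : ∀ n ∈ N, ∀ r ∈ A.core H, A.cell (n * r) = n • A.cell r := fun n hn r hr => by
    rw [F.cell_mul hN hinf hn hr, SqHull.cell_eq F hN hN2 hn, Set.singleton_mul]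
    rfl
  have hsub : ∀ a ∈ U, a • (A.core H : Set G) ⊆ U := by
    rintro a ha _ ⟨r, hr, rfl⟩
    exact U.mul_mem ha (hRU hr)
  have hUA : A.IsASubgroup U := by
    refine A.isASet_iff.2 fun u hu => ?_
    obtain ⟨r, hr, rfl | rfl | rfl | rfl⟩ := F.mem_sup_zpowers.1 hu
    · exact Set.Subset.trans (hRA.cell_subset hr) hRU
    · rw [hcell1 r hr]; exact hsub _ hcU
    · exact (hsq.cell_subset ⟨r, hr, rfl⟩).trans (hsub _ (U.pow_mem hcU 2))
    · rw [hcell3 r hr]; exact hsub _ (U.pow_mem hcU 3)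
  refine ⟨U, N, hNU, hUA, hN.isASubgroup, SqHull.ne_bot F hN, ?_,
    fun X hX hXU => ?_, Or.inr (Or.inr ⟨?_, ?_, ?_, fun AU hAU =>
      ⟨(A.core H).subgroupOf U, ?_, ?_, ?_⟩⟩)⟩
  · intro htop
    refine hne (le_antisymm hR fun h hh => ?_)
    obtain ⟨r, hr, h1⟩ := F.mem_sup_zpowers.1 (htop ▸ Subgroup.mem_top h : h ∈ U)
    have := F.mul_notMem (hR hr)
    rcases h1 with rfl | rfl | rfl | rfl
    exacts [hr, absurd hh this.1, absurd hh this.2.1, absurd hh this.2.2]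
  · rcases F.basic_cases_of_ne hC hne hX with h | h | ⟨d, hd, rfl⟩ | ⟨-, rfl | rfl⟩
    · exact absurd (h.trans hRU) hXU
    · exact subset_rad (hN.le_stabilizer (.of_basic hX) h)
    · exact absurd (hUA.cell_subset (U.mul_mem (hNU hN.sq_mem) (hRU hd))) hXU
    · exact absurd (hsub _ hcU) hXU
    · exact absurd (hsub _ (U.pow_mem hcU 3)) hXU
  · rw [hUe, Nat.card_zpowers, F.orderOf_mul_eq (hR he) he1]
  · rw [hUe]; infer_instance
  · exact SqHull.card_eq_two F hN hN2
  · exact hRA.restrict hAU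
  · rw [Nat.card_congr (Subgroup.subgroupOfEquivOfLe hRU).toEquiv, hcard]
  · refine tensorWreathBasic_eq hNU hRU hRA hcell2 (fun u hu huS => ?_) hAU
    obtain ⟨r, hr, h⟩ := F.mem_sup_zpowers.1 hu
    have hrR : r • (A.core H : Set G) = A.core H := by
      exact smul_coe_set hr
    rcases h with rfl | rfl | rfl | rfl
    · exact absurd (Subgroup.mem_sup_right hr) huS
    · rw [hcell1 r hr, mul_smul, hrR]
    · exact absurd (Subgroup.mul_mem_sup hN.sq_mem hr) huS
    · rw [hcell3 r hr, mul_smul, hrR]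

end Frame

namespace Frame

variable {G : Type*} [CommGroup G] [Finite G] {A : SRing G} {p : ℕ} {c : G} {H : Subgroup G}
  {X : Set G}

lemma isCyclotomic_restrict (F : Frame p c H) {N : Subgroup G} (hN : SqHull A c H N)
    (h : ∀ n ∈ N, n = 1 ∨ n = c ^ 2) (hcard : Nat.card (A.core H) = p)
    {AU : SRing (N ⊔ A.core H : Subgroup G)}
    (hAU : AU.basic = restrictBasic A (N ⊔ A.core H)) : AU.IsCyclotomic := by
  have hNU : N ≤ N ⊔ A.core H := le_sup_left
  have hRU : A.core H ≤ N ⊔ A.core H := le_sup_right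
  refine SRing.isCyclotomic_of_prime_compl (q := p) (D := N.subgroupOf (N ⊔ A.core H))
    (E := (A.core H).subgroupOf (N ⊔ A.core H)) F.prime ?_ ?_ ?_ ?_ ?_
  · rw [← Subgroup.subgroupOf_sup hNU hRU, Subgroup.subgroupOf_self]
  · rw [Nat.card_congr (Subgroup.subgroupOfEquivOfLe hRU).toEquiv, hcard]
  · rw [Nat.card_congr (Subgroup.subgroupOfEquivOfLe hNU).toEquiv, SqHull.card_eq_two F hN h]
    exact Nat.coprime_two_left.2 F.odd
  · intro d hd
    have h1 := (SRing.IsASet.cell (A := A) (d : G)).restrict hAU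
    have h0 : A.cell (d : G) = {(d : G)} := SqHull.cell_eq F hN h hd
    rwa [h0, show (Subtype.val ⁻¹' {(d : G)} : Set (N ⊔ A.core H : Subgroup G)) = {d} from
      Set.ext fun _ => Subtype.ext_iff.symm] at h1
  · exact (SRing.isASubgroup_core H).restrict hAU

lemma exists_mem_of_sqHull (F : Frame p c H) (hC : ¬ A.IsASubgroup (Subgroup.zpowers c))
    {N : Subgroup G} (hN : SqHull A c H N) (h : ¬ ∀ n ∈ N, n = 1 ∨ n = c ^ 2) :
    ∃ h ∈ N, h ∈ H ∧ h ≠ 1 := by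
  have key : ∀ i, ∀ k ∈ H, k ≠ 1 → c ^ i * k ∈ N → ∃ h ∈ N, h ∈ H ∧ h ≠ 1 := by
    intro i k hk hk1 hn
    refine ⟨k ^ 4, ?_, H.pow_mem hk 4, fun h4 => hk1 ?_⟩
    · have := N.pow_mem hn 4
      rwa [mul_pow, ← pow_mul, mul_comm i, pow_mul, F.pow_four, one_pow, one_mul] at this
    · have h1 : orderOf k ∣ Nat.gcd 4 p := Nat.dvd_gcd (orderOf_dvd_of_pow_eq_one h4)
        (orderOf_dvd_of_pow_eq_one (F.pow_eq_one k hk))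
      rw [F.coprime_four, Nat.dvd_one] at h1
      exact orderOf_eq_one_iff.1 h1
  by_contra! hcon
  have h1 : ∀ n ∈ N, n ∈ Subgroup.zpowers c := by
    intro n hn
    obtain ⟨i, k, hk, rfl⟩ := F.exists_pow_mul n
    by_cases hk1 : k = 1
    · rw [hk1, mul_one]
      exact Subgroup.npow_mem_zpowers c i
    · obtain ⟨x, hx, hxH, hx1⟩ := key i k hk hk1 hn
      exact absurd (hcon x hx hxH) hx1
  have hcN : c ∉ N := fun hc => hC (by
    rw [← le_antisymm (fun n hn => h1 n hn) ((Subgroup.zpowers_le).2 hc)]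
    exact hN.isASubgroup)
  refine h fun n hn => ?_
  obtain ⟨i, rfl⟩ := mem_powers_iff_mem_zpowers.2 (h1 n hn)
  simp only at hn ⊢
  rw [pow_eq_pow_mod i F.pow_four] at hn ⊢
  have : i % 4 < 4 := Nat.mod_lt _ (by norm_num)
  interval_cases i % 4
  · simp
  · exact absurd (by simpa using hn) hcN
  · simp
  · rw [← F.inv_eq, inv_mem_iff] at hn
    exact absurd hn hcN

lemma conclusion_of_sup_ne_top (F : Frame p c H) (hC : ¬ A.IsASubgroup (Subgroup.zpowers c))
    (hne : A.core H ≠ H) {N : Subgroup G} (hN : SqHull A c H N)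
    (hinf : ∀ n ∈ N, n ∈ A.core H → n = 1) (hcard : Nat.card (A.core H) = p)
    (htop : N ⊔ A.core H ≠ ⊤) (hodd : c • (A.core H : Set G) ∉ A.basic)
    (hodd3 : c ^ 3 • (A.core H : Set G) ∉ A.basic) : WreathConclusion p A := by
  have hR := SRing.core_le (A := A) H
  have hRA := SRing.isASubgroup_core (A := A) H
  obtain ⟨e, he, he1⟩ := F.exists_ne_one_of_card hcard
  have hRe : ∀ r ∈ A.core H, ∃ k : ℕ, r = e ^ k := fun r hr =>
    exists_pow_of_card_eq_prime F.prime hcard he he1 hr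
  set U := N ⊔ A.core H with hU
  have hNU : N ≤ U := le_sup_left
  have hRU : A.core H ≤ U := le_sup_right
  have hUA : A.IsASubgroup U := hN.isASubgroup.sup hRA
  have hst : ∀ X ∈ A.basic, ¬ X ⊆ (U : Set G) → N ≤ MulAction.stabilizer G X := by
    intro X hX hXU
    rcases F.basic_cases_of_ne hC hne hX with h | h | ⟨d, hd, rfl⟩ | ⟨-, rfl | rfl⟩
    · exact absurd (h.trans hRU) hXU
    · exact hN.le_stabilizer (.of_basic hX) h
    · exact absurd (hUA.cell_subset (U.mul_mem (hNU hN.sq_mem) (hRU hd))) hXU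
    · exact absurd hX hodd
    · exact absurd hX hodd3
  have hmin : ∀ AS : SRing (U ⧸ N.subgroupOf U), AS.basic = secBasic A U N →
      AS.IsCayleyMinimal := by
    intro AS _
    have : IsCyclic (U ⧸ N.subgroupOf U) := isCyclic_section (hRU he) fun u hu => by
      obtain ⟨n, hn, r, hr, rfl⟩ := Subgroup.mem_sup.1 hu
      obtain ⟨k, rfl⟩ := hRe r hr
      exact ⟨k, n, hn, mul_comm _ _⟩
    exact SRing.isCayleyMinimal_of_isCyclic
  have hCA' : (∀ AU : SRing U, AU.basic = restrictBasic A U → AU.IsCyclotomic) ∨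
      (∀ AQ : SRing (G ⧸ N), AQ.basic = quotBasic A N → AQ.IsCyclotomic) →
      WreathConclusion p A := fun h => ⟨U, N, hNU, hUA, hN.isASubgroup, SqHull.ne_bot F hN, htop,
    fun X hX hXU => subset_rad (hst X hX hXU), Or.inr (Or.inl ⟨h, hmin⟩)⟩
  by_cases hN2 : ∀ n ∈ N, n = 1 ∨ n = c ^ 2
  · exact hCA' (Or.inl fun AU hAU => F.isCyclotomic_restrict hN hN2 hcard hAU)
  obtain ⟨k, hkN, hkH, hk1⟩ := F.exists_mem_of_sqHull hC hN hN2
  have hH : (N ⊓ H) ⊔ A.core H = H := by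
    refine F.sup_eq inf_le_right (fun h => hk1 ?_) hR fun h => he1 (hinf e (h he).1 he)
    rw [← Subgroup.mem_bot, ← h]
    exact ⟨hkN, hkH⟩
  have hHU : H ≤ U := hH.ge.trans (sup_le_sup_right inf_le_left _)
  have hzU : c ^ 2 ∈ U := hNU hN.sq_mem
  have hcU : c ∉ U := fun hc => htop (eq_top_iff.2 fun g _ => by
    obtain ⟨i, h, hh, rfl⟩ := F.exists_pow_mul g
    exact U.mul_mem (U.pow_mem hc i) (hHU hh))
  by_cases hcN : ∀ x ∈ A.cell c, c⁻¹ * x ∈ N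
  · refine hCA' (Or.inr fun AQ hAQ => F.isCyclotomic_quot hN.isASubgroup hRA hcN he
      (fun h => he1 (hinf e h he)) (F.pow_eq_one e (hR he)) (fun w hw => ?_)
      (by rwa [sup_comm]) hAQ)
    obtain ⟨k, rfl⟩ := hRe w hw
    exact ⟨k, 1, N.one_mem, (mul_one _).symm⟩
  push Not at hcN
  obtain ⟨x, hx, hxN⟩ := hcN
  have hcst : ∀ n ∈ N, ∀ y ∈ A.cell c, n * y ∈ A.cell c := fun n hn => mem_stabilizer_set_iff.1
    (hst _ (A.cell_mem_basic c) (fun h => hcU (h (A.mem_cell c))) hn)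
  obtain ⟨h, hh, hhc, hhN⟩ : ∃ h ∈ H, c * h ∈ A.cell c ∧ h ∉ N := by
    have hxU : x ∉ U := fun h => hcU (hUA.cell_subset h (A.mem_cell_comm hx))
    obtain ⟨h, hh, rfl | rfl | rfl | rfl⟩ := F.decomp x
    · exact absurd (hHU hh) hxU
    · exact ⟨h, hh, hx, by rwa [inv_mul_cancel_left] at hxN⟩
    · exact absurd (U.mul_mem hzU (hHU hh)) hxU
    · have h1 := hcst _ hN.sq_mem _ hx
      rw [F.mul_rules.2.2.2.2.2.1] at h1
      refine ⟨h, hh, h1, fun hhN => hxN ?_⟩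
      rw [pow_succ', mul_assoc, inv_mul_cancel_left]
      exact N.mul_mem hN.sq_mem hhN
  obtain ⟨n, hn, r, hr, rfl⟩ := Subgroup.mem_sup.1 (hH.ge hh)
  have hrc : c * r ∈ A.cell c := by
    have := hcst _ (N.inv_mem hn.1) _ hhc
    rwa [mul_left_comm c, inv_mul_cancel_left] at this
  have hr1 : r ≠ 1 := by
    rintro rfl
    exact hhN (by simpa using hn.1)
  have hRc : ∀ s ∈ A.core H, c * s ∈ A.cell c := by
    intro s hs
    by_cases hs1 : s = 1
    · rw [hs1, mul_one]
      exact A.mem_cell c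
    obtain ⟨k, rfl⟩ := exists_pow_of_card_eq_prime F.prime hcard hr hr1 hs
    have hpk : ¬ p ∣ k := by
      rintro ⟨m, rfl⟩
      exact hs1 (by rw [pow_mul, F.pow_eq_one r (hR hr), one_pow])
    obtain ⟨m, hm, hm', hco⟩ := F.exists_pow 1 k
    have h1 := A.pow_cell (hco odd_one hpk) c
    rw [hm, pow_one] at h1
    rw [← h1]
    exact ⟨c * r, hrc, by simp only [mul_pow, hm, hm' r (hR hr), pow_one]⟩
  have hUc : ∀ u ∈ U, c * u ∈ A.cell c := by
    intro u hu
    obtain ⟨n, hn, s, hs, rfl⟩ := Subgroup.mem_sup.1 hu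
    rw [mul_left_comm]
    exact hcst n hn _ (hRc s hs)
  have hcompl : ∀ g, g ∉ U → ∃ u ∈ U, g = c * u := by
    intro g hg
    obtain ⟨h, hh, rfl | rfl | rfl | rfl⟩ := F.decomp g
    · exact absurd (hHU hh) hg
    · exact ⟨h, hHU hh, rfl⟩
    · exact absurd (U.mul_mem hzU (hHU hh)) hg
    · exact ⟨c ^ 2 * h, U.mul_mem hzU (hHU hh), (F.mul_rules.2.1 h).symm⟩
  refine ⟨U, U, le_rfl, hUA, hUA, fun h => he1 ?_, htop, fun X hX hXU => subset_rad fun u hu => ?_,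
    Or.inl condCA_self⟩
  · rw [← Subgroup.mem_bot, ← h]
    exact hRU he
  · obtain ⟨g, hgX, hgU⟩ := Set.not_subset.1 hXU
    obtain ⟨v, hv, rfl⟩ := hcompl g hgU
    rw [mem_stabilizer_set_iff, A.eq_cell hX hgX, A.cell_eq_of_mem (hUc v hv)]
    intro y hy
    have hyU : y ∉ U := fun h => hcU (hUA.cell_subset h (A.mem_cell_comm hy))
    obtain ⟨w, hw, rfl⟩ := hcompl y hyU
    rw [mul_left_comm]
    exact hUc _ (U.mul_mem hu hw)

lemma conclusion_of_not_isASubgroup (F : Frame p c H)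
    (hC : ¬ A.IsASubgroup (Subgroup.zpowers c)) (hHA : ¬ A.IsASubgroup H) :
    A.basic.ncard = 2 ∨ TensorConclusion A ∨ WreathConclusion p A := by
  have hne : A.core H ≠ H := fun h => hHA (h ▸ SRing.isASubgroup_core H)
  by_cases hcore : A.core H = ⊥
  · exact (F.conclusion_of_core_eq_bot hC hcore hne).imp_right Or.inr
  obtain ⟨N, hN⟩ := F.exists_sqHull (A := A)
  have hcard : Nat.card (A.core H) = p := F.card_eq (SRing.core_le H) hcore hne
  by_cases hle : A.core H ≤ N
  · exact Or.inr (Or.inr (F.conclusion_of_core_le hC hcore hne hN hle))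
  have hinf : ∀ n ∈ N, n ∈ A.core H → n = 1 := by
    intro n hn hnc
    by_contra hn1
    refine hle fun r hr => ?_
    obtain ⟨k, rfl⟩ := exists_pow_of_card_eq_prime F.prime hcard hnc hn1 hr
    exact N.pow_mem hn k
  by_cases htop : N ⊔ A.core H = ⊤
  · exact Or.inr (Or.inl (F.tensorConclusion hN hinf hcore htop))
  refine Or.inr (Or.inr ?_)
  by_cases hodd : c • (A.core H : Set G) ∈ A.basic
  · exact F.conclusion_of_odd_basic hC hne hN hinf hcard hodd
  refine F.conclusion_of_sup_ne_top hC hne hN hinf hcard htop hodd fun h3 => hodd ?_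
  convert A.inv_mem _ h3 using 1
  rw [← F.inv_eq]
  ext g
  simp only [Set.mem_smul_set_iff_inv_smul_mem, Set.mem_inv, smul_eq_mul, SetLike.mem_coe]
  rw [← inv_mem_iff, mul_inv, inv_inv]

end Frame

namespace Frame

variable {G : Type*} [CommGroup G] [Finite G] {A : SRing G} {p : ℕ} {c : G} {H : Subgroup G}
  {X : Set G}

lemma isASet_preimage_mul (F : Frame p c H) (hX : A.IsASet X) (hXc : ∀ x ∈ X, x * c⁻¹ ∈ H) :
    A.IsASet {g | c * g ∈ X} := by
  have hn : ∀ g, g * c⁻¹ ∉ H → g ∉ X := fun g hg h => hg (hXc g h)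
  convert (hX.oddFibre F).oddFibre F using 1
  ext g
  obtain ⟨r1, r2, r3, -⟩ := F.mul_rules
  obtain ⟨h, hh, hg⟩ := F.decomp g
  obtain ⟨n1, n2, n3⟩ := F.mul_notMem hh
  have h0 : h ∉ X := hn h (by rwa [F.inv_eq, mul_comm])
  have h2 : c ^ 2 * h ∉ X := hn _ (by rwa [← r1, mul_comm, inv_mul_cancel_left])
  have h3 : c ^ 3 * h ∉ X := hn _ (by rwa [← r2, mul_comm, inv_mul_cancel_left])
  rw [Set.mem_ofPred_eq]
  rcases hg with rfl | rfl | rfl | rfl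
  · rw [F.mem_oddFibre hh, F.mem_oddFibre hh, F.sq_mul_mem_oddFibre hh]
    tauto
  · rw [r1]
    exact iff_of_false h2 (F.mul_notMem_oddFibre hh).1
  · rw [r2, F.sq_mul_mem_oddFibre hh]
    have := F.mul_notMem_oddFibre (X := X) hh
    tauto
  · rw [r3]
    exact iff_of_false h0 (F.mul_notMem_oddFibre hh).2

lemma mem_cell_iff (F : Frame p c H) (hHc : ∀ g, ∀ x ∈ A.cell g, x * g⁻¹ ∈ H) {x : G} :
    x ∈ A.cell c ↔ c⁻¹ * x ∈ MulAction.stabilizer G (A.cell c) := by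
  have h1 := F.isASet_preimage_mul (.cell c) (hHc c)
  have h2 : ∀ y, c * y ∈ A.cell c → ∀ y', c * y' ∈ A.cell c → c * (y * y') ∈ A.cell c := by
    intro y hy y' hy'
    have := (h1.transporter (.cell (A := A) c)).cell_subset (g := c) (fun y hy => hy) hy y' hy'
    rwa [mul_assoc] at this
  refine ⟨fun hx => mem_stabilizer_set_iff.2 fun y hy => ?_, fun hx => ?_⟩
  · have := h2 (c⁻¹ * x) (by rwa [mul_inv_cancel_left]) (c⁻¹ * y) (by rwa [mul_inv_cancel_left])
    rwa [mul_left_comm c, mul_inv_cancel_left] at this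
  · simpa using mem_stabilizer_set_iff.1 hx c (A.mem_cell c)

lemma stabilizer_cell_le (F : Frame p c H) (hX : A.IsASet X) (hXc : ∀ x ∈ X, x * c⁻¹ ∈ H) :
    MulAction.stabilizer G (A.cell c) ≤ MulAction.stabilizer G X := by
  refine fun r hr => mem_stabilizer_set_iff.2 fun x hx => ?_
  have := ((F.isASet_preimage_mul hX hXc).transporter hX).cell_subset (g := c) (fun y hy => hy)
    (mem_stabilizer_set_iff.1 hr c (A.mem_cell c)) (c⁻¹ * x)
    (by rwa [Set.mem_ofPred_eq, mul_inv_cancel_left])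
  rwa [mul_assoc, mul_inv_cancel_left] at this

lemma conclusion_of_isASubgroup (F : Frame p c H) (hC : ¬ A.IsASubgroup (Subgroup.zpowers c))
    (hH : A.IsASubgroup H) (hHc : ∀ g, ∀ x ∈ A.cell g, x * g⁻¹ ∈ H) : WreathConclusion p A := by
  set R := MulAction.stabilizer G (A.cell c) with hR
  have hRA : A.IsASubgroup R := SRing.IsASet.stabilizer (.cell c)
  have hcR : ∀ x ∈ A.cell c, c⁻¹ * x ∈ R := fun x hx => (F.mem_cell_iff hHc).1 hx
  have hRH : R ≤ H := fun r hr => by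
    simpa using hHc c _ (mem_stabilizer_set_iff.1 hr c (A.mem_cell c))
  have hR1 : R ≠ ⊥ := fun h => hC <| F.isASubgroup_zpowers (.cell c)
    (fun g hg => Or.inl (by
      have := hcR g hg
      rw [h, Subgroup.mem_bot, inv_mul_eq_one] at this
      exact this.symm)) ⟨c, A.mem_cell c⟩
  set M : Subgroup G := H.comap (powMonoidHom 2) with hM
  have hmem : ∀ g, g ∈ M ↔ g ^ 2 ∈ H := fun g => Iff.rfl
  have hHM : H ≤ M := fun h hh => H.pow_mem hh 2
  have hzM : c ^ 2 ∈ M := by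
    rw [hmem, ← pow_mul, F.pow_four]
    exact H.one_mem
  have hcM : c ∉ M := F.sq_notMem
  have hMA : A.IsASubgroup M := by
    refine A.isASet_iff.2 fun g hg x hx => ?_
    have := M.mul_mem (hHM (hHc g x hx)) hg
    rwa [inv_mul_cancel_right] at this
  have hdec : ∀ u ∈ M, ∃ h ∈ H, u = h ∨ u = c ^ 2 * h := by
    intro u hu
    obtain ⟨h, hh, rfl | rfl | rfl | rfl⟩ := F.decomp u
    · exact ⟨u, hh, Or.inl rfl⟩
    · exact absurd ((M.mul_mem_cancel_right (hHM hh)).1 hu) hcM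
    · exact ⟨h, hh, Or.inr rfl⟩
    · rw [M.mul_mem_cancel_right (hHM hh), pow_succ, M.mul_mem_cancel_left hzM] at hu
      exact absurd hu hcM
  have hwr : ∀ X ∈ A.basic, ¬ X ⊆ (M : Set G) → R ≤ MulAction.stabilizer G X := by
    intro X hX hXM
    have key : ∀ h ∈ H, ∀ x ∈ A.cell (c * h), x * c⁻¹ ∈ H := by
      intro h hh x hx
      have := H.mul_mem (hHc _ x hx) hh
      rwa [mul_inv, mul_assoc, inv_mul_cancel_right] at this
    obtain ⟨g, hgX, hgM⟩ := Set.not_subset.1 hXM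
    obtain ⟨h, hh, rfl | rfl | rfl | rfl⟩ := F.decomp g
    · exact absurd (hHM hh) hgM
    · rw [A.eq_cell hX hgX]
      exact F.stabilizer_cell_le (.cell _) (key h hh)
    · exact absurd (M.mul_mem hzM (hHM hh)) hgM
    · have hinv : c * h⁻¹ ∈ X⁻¹ := by
        rwa [Set.mem_inv, mul_inv, inv_inv, F.inv_eq]
      intro r hr
      have h1 := F.stabilizer_cell_le (.of_basic (A.inv_mem X hX)) (by
        rw [A.eq_cell (A.inv_mem X hX) hinv]
        exact key _ (H.inv_mem hh)) (R.inv_mem hr)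
      rw [mem_stabilizer_set_iff] at h1 ⊢
      intro x hx
      simpa [mul_comm] using h1 x⁻¹ (by simpa using hx)
  have hconc : CondCA A M R ∨ CondCA' A M R ∨ CondCA'' p A M R → WreathConclusion p A :=
    fun h => ⟨M, R, hRH.trans hHM, hMA, hRA, hR1, fun h => hcM (h ▸ Subgroup.mem_top c),
      fun X hX hXM => subset_rad (hwr X hX hXM), h⟩
  by_cases hHR : H ≤ R
  · refine hconc (Or.inl (condCA_of_relIndex ?_))
    rw [show R = H from le_antisymm hRH hHR, Subgroup.relIndex_eq_two_iff.2]
    refine ⟨c ^ 2, hzM, fun b hb => ?_⟩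
    obtain ⟨h, hh, rfl | rfl⟩ := hdec b hb
    · exact Or.inr ⟨hh, by rw [mul_comm]; exact (F.mul_notMem hh).2.1⟩
    · exact Or.inl ⟨by rwa [mul_comm, F.mul_rules.2.2.2.2.1], (F.mul_notMem hh).2.1⟩
  obtain ⟨e, he, heR⟩ := SetLike.not_le_iff_exists.1 hHR
  have hHe : ∀ h ∈ H, ∃ k : ℕ, ∃ l ∈ R, h = e ^ k * l := by
    intro h hh
    rw [← F.sup_eq hRH hR1 ((Subgroup.zpowers_le).2 he)
      (fun h => heR (h (Subgroup.mem_zpowers e)))] at hh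
    obtain ⟨l, hl, y, hy, rfl⟩ := Subgroup.mem_sup.1 hh
    obtain ⟨k, rfl⟩ := mem_powers_iff_mem_zpowers.2 hy
    exact ⟨k, l, hl, mul_comm _ _⟩
  refine hconc (Or.inr (Or.inl ⟨Or.inr fun AQ hAQ => F.isCyclotomic_quot hRA hH hcR he heR
    (F.pow_eq_one e he) hHe le_sup_left hAQ, fun AS _ => ?_⟩))
  have : IsCyclic (M ⧸ R.subgroupOf M) := by
    refine isCyclic_section (g := c ^ 2 * e) (M.mul_mem hzM (hHM he)) fun u hu => ?_
    obtain ⟨i, h, hh, hu'⟩ : ∃ i : ℕ, ∃ h ∈ H, u = (c ^ i) ^ 2 * h := by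
      obtain ⟨h, hh, rfl | rfl⟩ := hdec u hu
      · exact ⟨0, u, hh, by simp⟩
      · exact ⟨1, h, hh, by simp⟩
    obtain ⟨k, l, hl, rfl⟩ := hHe h hh
    obtain ⟨m, hm, hm', -⟩ := F.exists_pow i k
    refine ⟨m, l, hl, ?_⟩
    rw [hu', mul_pow, hm' e he, pow_right_comm c 2 m, hm, mul_assoc]
  exact SRing.isCayleyMinimal_of_isCyclic

end Frame

lemma exists_frame {p : ℕ} (hp : p.Prime) (hodd : Odd p) {G : Type*} [CommGroup G]
    {C H : Subgroup G} (hC : Nonempty (C ≃* Multiplicative (ZMod 4)))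
    (hH : Nonempty (H ≃* Multiplicative (ZMod p) × Multiplicative (ZMod p)))
    (hinf : C ⊓ H = ⊥) (hsup : C ⊔ H = ⊤) : ∃ c, C = Subgroup.zpowers c ∧ Frame p c H := by
  obtain ⟨φ⟩ := hC
  obtain ⟨ψ⟩ := hH
  have : NeZero p := ⟨hp.ne_zero⟩
  set c : C := φ.symm (Multiplicative.ofAdd 1) with hc
  have hpow : ∀ n : ℕ, φ (c ^ n) = Multiplicative.ofAdd (n : ZMod 4) := fun n => by
    rw [map_pow, hc, MulEquiv.apply_symm_apply, ← ofAdd_nsmul, nsmul_one]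
  have hgen : ∀ x ∈ C, ∃ i : ℕ, x = (c : G) ^ i := fun x hx => by
    refine ⟨(φ ⟨x, hx⟩).toAdd.val, ?_⟩
    rw [← Subgroup.coe_pow]
    refine congrArg Subtype.val (φ.injective (a₁ := ⟨x, hx⟩) ?_)
    rw [hpow, ZMod.natCast_zmod_val, ofAdd_toAdd]
  have hpow1 : ∀ n : ℕ, (c : G) ^ n = 1 ↔ 4 ∣ n := fun n => by
    rw [← Subgroup.coe_pow, OneMemClass.coe_eq_one, ← φ.map_eq_one_iff, hpow, ofAdd_eq_one,
      ZMod.natCast_eq_zero_iff]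
  refine ⟨c, le_antisymm (fun x hx => ?_) ((Subgroup.zpowers_le).2 c.2), hp, hodd,
    (hpow1 4).2 dvd_rfl, fun h => ?_, fun h hh => ?_, fun g => ?_, ?_⟩
  · obtain ⟨i, rfl⟩ := hgen x hx
    exact Subgroup.npow_mem_zpowers _ i
  · have h1 : (c : G) ^ 2 ∈ C ⊓ H := ⟨C.pow_mem c.2 2, h⟩
    rw [hinf, Subgroup.mem_bot, hpow1] at h1
    omega
  · have h1 : ∀ a : Multiplicative (ZMod p), a ^ p = 1 := fun a => by
      rw [← toAdd_eq_zero, toAdd_pow, nsmul_eq_mul, CharP.cast_eq_zero, zero_mul]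
    have h2 : (⟨h, hh⟩ : H) ^ p = 1 := ψ.injective (by
      rw [map_pow, map_one]
      exact Prod.ext (h1 _) (h1 _))
    exact congrArg Subtype.val h2
  · obtain ⟨x, hx, h, hh, rfl⟩ := Subgroup.mem_sup.1 (hsup ▸ Subgroup.mem_top g : g ∈ C ⊔ H)
    obtain ⟨i, rfl⟩ := hgen x hx
    exact ⟨i, h, hh, rfl⟩
  · rw [Nat.card_congr ψ.toEquiv, Nat.card_prod, Nat.card_congr Multiplicative.toAdd, Nat.card_zmod,
      pow_two]

/-- In the setting of the classification over `C₄ × C_p × C_p`,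
if `C` is not an `𝒜`-subgroup then `rk(𝒜) = 2`, or `𝒜` is a tensor product of two
S-rings over proper nontrivial subgroups, or `𝒜` is a nontrivial `S = U/L`-wreath
product satisfying one of (CA), (CA'), (CA''). -/
theorem stmt16 (p : ℕ) (hp : p.Prime) (hodd : Odd p)
    (G : Type*) [CommGroup G] [Finite G] (C H : Subgroup G)
    (hC : Nonempty (↥C ≃* Multiplicative (ZMod 4)))
    (hH : Nonempty (↥H ≃* Multiplicative (ZMod p) × Multiplicative (ZMod p)))
    (hinf : C ⊓ H = ⊥) (hsup : C ⊔ H = ⊤)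
    (K : Subgroup (Equiv.Perm G)) (hK : InSup2Min K)
    (A : SRing G) (hA : A.basic = VBasic K)
    (hCA : ¬ A.IsASubgroup C) :
    A.basic.ncard = 2 ∨ TensorConclusion A ∨ WreathConclusion p A := by
  obtain ⟨c, rfl, F⟩ := exists_frame hp hodd hC hH hinf hsup
  by_cases hHA : A.IsASubgroup H
  · exact Or.inr (Or.inr (F.conclusion_of_isASubgroup hCA hHA fun g x hx =>
      hK.mul_inv_mem F hA hHA hx))
  · exact F.conclusion_of_not_isASubgroup hCA hHA

end Paper
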